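/- arXiv:math-ph/0312001 — 3 statements merged into one kernel-verified Lean document; each statement's English description precedes it below -/
import Mathlib

section
/- For all real x, y with x ≠ y, (Ai(x)Ai′(y) − Ai′(x)Ai(y))/(x − y) = ∫_0^{∞} Ai(x+u)Ai(y+u) du; moreover for every real x, Ai′(x)² − x·Ai(x)² = ∫_0^{∞} Ai(x+u)² du. -/
open MeasureTheory Filter Set

noncomputable section

/-- `Ai` is the Airy function: an entire solution of `Ai'' = z·Ai` which is real on the real
axis, where it is given by the standard oscillatory integral representation. -/
def IsAiryAi (Ai : ℂ → ℂ) : Prop :=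
  Differentiable ℂ Ai ∧ (∀ z, deriv (deriv Ai) z = z * Ai z) ∧
    ∀ x : ℝ, (Ai x).im = 0 ∧
      Tendsto (fun R : ℝ => (1 / Real.pi) * ∫ t in (0:ℝ)..R, Real.cos (t ^ 3 / 3 + x * t))
        atTop (nhds ((Ai x).re))

/-- The restriction of the Airy function to the real axis. -/
def AiR (Ai : ℂ → ℂ) (x : ℝ) : ℝ := (Ai x).re

/-- First-derivative test (van der Corput) for the Airy phase. -/
lemma airy_osc_bound (x : ℝ) (hx : 0 < x) (R : ℝ) (hR : 0 ≤ R) :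
    |∫ t in (0:ℝ)..R, Real.cos (t ^ 3 / 3 + x * t)| ≤ 1 / x := by
  have hc : Continuous (fun t : ℝ => Real.cos (t ^ 3 / 3 + x * t)) := by fun_prop
  have hI : ∀ r, HasDerivAt (fun r => ∫ t in (0:ℝ)..r, Real.cos (t ^ 3 / 3 + x * t))
      (Real.cos (r ^ 3 / 3 + x * r)) r := fun r =>
    intervalIntegral.integral_hasDerivAt_right (hc.intervalIntegrable _ _)
      (hc.stronglyMeasurableAtFilter _ _) hc.continuousAt
  have hp : ∀ r : ℝ, 0 < r ^ 2 + x := fun r => by positivity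
  have hph : ∀ r : ℝ, HasDerivAt (fun r : ℝ => r ^ 3 / 3 + x * r) (r ^ 2 + x) r := fun r => by
    have := ((hasDerivAt_pow 3 r).div_const 3).add ((hasDerivAt_id r).const_mul x)
    refine this.congr_deriv ?_
    push_cast; ring
  have hpd : ∀ r : ℝ, HasDerivAt (fun r : ℝ => r ^ 2 + x) (2 * r) r := fun r => by
    have := (hasDerivAt_pow 2 r).add_const x
    refine this.congr_deriv ?_
    push_cast; ring
  have key : ∀ e : ℝ, |e| = 1 →
      e * (∫ t in (0:ℝ)..R, Real.cos (t ^ 3 / 3 + x * t)) ≤ 1 / x := by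
    intro e he
    have hD : ∀ r : ℝ, HasDerivAt (fun r : ℝ =>
        e * ((∫ t in (0:ℝ)..r, Real.cos (t ^ 3 / 3 + x * t))
          - Real.sin (r ^ 3 / 3 + x * r) / (r ^ 2 + x)) + (r ^ 2 + x)⁻¹)
        ((e * Real.sin (r ^ 3 / 3 + x * r) - 1) * (2 * r) / (r ^ 2 + x) ^ 2) r := by
      intro r
      have h1 := (((hI r).sub ((hph r).sin.div (hpd r) (hp r).ne')).const_mul e).add
        ((hpd r).inv (hp r).ne')
      refine h1.congr_deriv ?_
      have := (hp r).ne'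
      field_simp
      ring
    have hle : ∀ r : ℝ, e * Real.sin (r ^ 3 / 3 + x * r) ≤ 1 := fun r => by
      refine (le_abs_self _).trans ?_
      rw [abs_mul, he, one_mul]
      exact Real.abs_sin_le_one _
    have hanti := antitoneOn_of_deriv_nonpos (convex_Ici (0:ℝ))
      (fun r _ => (hD r).continuousAt.continuousWithinAt)
      (fun r _ => (hD r).differentiableAt.differentiableWithinAt) (by
        intro r hr
        rw [interior_Ici] at hr
        rw [(hD r).deriv]
        apply div_nonpos_of_nonpos_of_nonneg _ (sq_nonneg _)
        exact mul_nonpos_of_nonpos_of_nonneg (by linarith [hle r]) (by have := hr.out; linarith))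
    have h2 := hanti (show (0:ℝ) ∈ Ici (0:ℝ) from mem_Ici.2 le_rfl) (show R ∈ Ici (0:ℝ) from hR) hR
    simp only [intervalIntegral.integral_same] at h2
    norm_num at h2
    have h3 : e * (Real.sin (R ^ 3 / 3 + x * R) / (R ^ 2 + x)) ≤ (R ^ 2 + x)⁻¹ := by
      rw [← mul_div_assoc, inv_eq_one_div]
      exact div_le_div_of_nonneg_right (hle R) (hp R).le
    rw [one_div]
    linarith
  rw [abs_le]
  constructor
  · have := key (-1) (by norm_num)
    linarith
  · have := key 1 (by norm_num)
    linarith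

lemma airy_bound (Ai : ℂ → ℂ) (hAi : IsAiryAi Ai) (x : ℝ) (hx : 0 < x) :
    |AiR Ai x| ≤ 1 / x := by
  have h := (hAi.2.2 x).2
  refine le_of_tendsto h.abs ?_
  filter_upwards [eventually_ge_atTop (0:ℝ)] with R hR
  have h1 := airy_osc_bound x hx R hR
  rw [abs_mul]
  have h2 : |1 / Real.pi| ≤ 1 := by
    rw [abs_of_pos (by positivity), div_le_one Real.pi_pos]
    linarith [Real.pi_gt_three]
  calc _ ≤ 1 * (1 / x) := mul_le_mul h2 h1 (abs_nonneg _) zero_le_one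
    _ = _ := one_mul _

lemma airy_hasDerivAt (Ai : ℂ → ℂ) (hAi : IsAiryAi Ai) (x : ℝ) :
    HasDerivAt (AiR Ai) (deriv (AiR Ai) x) x := by
  have := (hAi.1 (x : ℂ)).hasDerivAt.real_of_complex
  exact (show DifferentiableAt ℝ (AiR Ai) x from this.differentiableAt).hasDerivAt

lemma airy_hasDerivAt2 (Ai : ℂ → ℂ) (hAi : IsAiryAi Ai) (x : ℝ) :
    HasDerivAt (deriv (AiR Ai)) (x * AiR Ai x) x := by
  have h1 : deriv (AiR Ai) = fun x : ℝ => (deriv Ai x).re := by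
    funext x
    exact HasDerivAt.deriv ((hAi.1 (x : ℂ)).hasDerivAt.real_of_complex)
  have hd : Differentiable ℂ (deriv Ai) := hAi.1.deriv
  have := (hd (x : ℂ)).hasDerivAt.real_of_complex
  rw [hAi.2.1 x] at this
  rw [h1]
  refine this.congr_deriv ?_
  simp [AiR]

lemma airy_integrable (Ai : ℂ → ℂ) (hAi : IsAiryAi Ai) (x y : ℝ) :
    IntegrableOn (fun u => AiR Ai (x + u) * AiR Ai (y + u)) (Ioi 0) := by
  have hc : Continuous (AiR Ai) :=
    continuous_iff_continuousAt.2 fun x => (airy_hasDerivAt Ai hAi x).continuousAt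
  have hc2 : Continuous (fun u => AiR Ai (x + u) * AiR Ai (y + u)) := by fun_prop
  refine ((hc2.locallyIntegrable).locallyIntegrableOn (Ici 0)).integrableOn_of_isBigO_atTop
    (g := fun u : ℝ => (1 + u ^ 2)⁻¹) ?_ (integrable_inv_one_add_sq.integrableAtFilter _)
    |>.mono_set Ioi_subset_Ici_self
  refine Asymptotics.IsBigO.of_bound 8 ?_
  filter_upwards [eventually_ge_atTop (2 * (|x| + |y| + 1))] with u hu
  have hx := abs_nonneg x
  have hy := abs_nonneg y
  have hx' := neg_abs_le x
  have hy' := neg_abs_le y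
  have hu0 : 0 < u := by linarith
  have a1 : |AiR Ai (x + u)| ≤ 2 / u := by
    refine (airy_bound Ai hAi _ (by linarith)).trans ?_
    rw [div_le_div_iff₀ (by linarith) hu0]; linarith
  have a2 : |AiR Ai (y + u)| ≤ 2 / u := by
    refine (airy_bound Ai hAi _ (by linarith)).trans ?_
    rw [div_le_div_iff₀ (by linarith) hu0]; linarith
  rw [Real.norm_eq_abs, abs_mul, Real.norm_eq_abs,
    abs_of_pos (show 0 < (1 + u ^ 2)⁻¹ by positivity)]
  calc _ ≤ (2 / u) * (2 / u) := mul_le_mul a1 a2 (abs_nonneg _) (by positivity)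
    _ ≤ 8 * (1 + u ^ 2)⁻¹ := by
      rw [div_mul_div_comm, ← div_eq_mul_inv, div_le_div_iff₀ (by positivity) (by positivity)]
      nlinarith

lemma airy_tendsto (Ai : ℂ → ℂ) (hAi : IsAiryAi Ai) : Tendsto (AiR Ai) atTop (nhds 0) := by
  refine squeeze_zero_norm' ?_ (tendsto_inv_atTop_zero (𝕜 := ℝ))
  filter_upwards [eventually_gt_atTop (0:ℝ)] with x hx
  rw [← one_div]
  exact airy_bound Ai hAi x hx

lemma airy_tendsto2 (Ai : ℂ → ℂ) (hAi : IsAiryAi Ai) :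
    Tendsto (fun x => x * AiR Ai x ^ 2) atTop (nhds 0) := by
  refine squeeze_zero_norm' ?_ (tendsto_inv_atTop_zero (𝕜 := ℝ))
  filter_upwards [eventually_gt_atTop (0:ℝ)] with x hx
  have h := airy_bound Ai hAi x hx
  rw [Real.norm_eq_abs, abs_mul, abs_of_pos hx, abs_pow]
  calc _ ≤ x * (1 / x) ^ 2 := by gcongr
    _ = x⁻¹ := by field_simp

lemma airy_energy_deriv (Ai : ℂ → ℂ) (hAi : IsAiryAi Ai) (x : ℝ) :
    HasDerivAt (fun x => deriv (AiR Ai) x ^ 2 - x * AiR Ai x ^ 2) (-(AiR Ai x ^ 2)) x := by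
  have h0 := airy_hasDerivAt Ai hAi x
  have h1 := airy_hasDerivAt2 Ai hAi x
  refine ((h1.pow 2).sub ((hasDerivAt_id x).mul (h0.pow 2))).congr_deriv ?_
  simp
  ring

lemma airy_energy_tendsto (Ai : ℂ → ℂ) (hAi : IsAiryAi Ai) :
    Tendsto (fun x => deriv (AiR Ai) x ^ 2 - x * AiR Ai x ^ 2) atTop (nhds 0) := by
  have hfi : IntegrableOn (fun x => -(AiR Ai x ^ 2)) (Ioi 0) := by
    have := (airy_integrable Ai hAi 0 0).neg
    refine this.congr_fun (fun u _ => ?_) measurableSet_Ioi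
    simp [sq]
  have hlim := tendsto_limUnder_of_hasDerivAt_of_integrableOn_Ioi
    (fun x (_ : x ∈ Ioi (0:ℝ)) => airy_energy_deriv Ai hAi x) hfi
  have hmv : ∀ x : ℝ, ∃ c ∈ Ioo x (x + 1), deriv (AiR Ai) c = AiR Ai (x + 1) - AiR Ai x := by
    intro x
    obtain ⟨c, hc, h⟩ := exists_deriv_eq_slope (AiR Ai) (show x < x + 1 by linarith)
      (fun z _ => (airy_hasDerivAt Ai hAi z).continuousAt.continuousWithinAt)
      (fun z _ => (airy_hasDerivAt Ai hAi z).differentiableAt.differentiableWithinAt)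
    exact ⟨c, hc, by rw [h]; simp⟩
  choose c hc hcd using hmv
  have hct : Tendsto c atTop atTop := tendsto_atTop_mono (fun x => (hc x).1.le) tendsto_id
  have h1 := hlim.comp hct
  have h2 : Tendsto (fun x => deriv (AiR Ai) (c x) ^ 2 - c x * AiR Ai (c x) ^ 2) atTop
      (nhds 0) := by
    have a := airy_tendsto Ai hAi
    have b := (((a.comp (tendsto_atTop_add_const_right atTop (1:ℝ) tendsto_id)).sub a).pow 2).sub
      ((airy_tendsto2 Ai hAi).comp hct)
    simp only [sub_zero, ne_eq, OfNat.ofNat_ne_zero, not_false_eq_true, zero_pow] at b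
    refine b.congr fun x => ?_
    simp [hcd]
  have := tendsto_nhds_unique h1 h2
  rwa [this] at hlim

lemma airy_deriv_tendsto (Ai : ℂ → ℂ) (hAi : IsAiryAi Ai) :
    Tendsto (deriv (AiR Ai)) atTop (nhds 0) := by
  have h := (airy_energy_tendsto Ai hAi).add (airy_tendsto2 Ai hAi)
  have h2 := h.sqrt
  simp only [sub_add_cancel, add_zero, Real.sqrt_zero, Real.sqrt_sq_eq_abs] at h2
  exact (tendsto_zero_iff_abs_tendsto_zero _).2 h2

theorem airy_kernel_integral_representation (Ai : ℂ → ℂ) (hAi : IsAiryAi Ai) :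
    (∀ x y : ℝ, x ≠ y →
        (AiR Ai x * deriv (AiR Ai) y - deriv (AiR Ai) x * AiR Ai y) / (x - y) =
          ∫ u in Ioi (0:ℝ), AiR Ai (x + u) * AiR Ai (y + u)) ∧
      ∀ x : ℝ, (deriv (AiR Ai) x) ^ 2 - x * (AiR Ai x) ^ 2 =
        ∫ u in Ioi (0:ℝ), (AiR Ai (x + u)) ^ 2 := by
  constructor
  · intro x y hxy
    have hd : ∀ u ∈ Ici (0:ℝ), HasDerivAt (fun u => AiR Ai (x + u) * deriv (AiR Ai) (y + u)
        - deriv (AiR Ai) (x + u) * AiR Ai (y + u))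
        ((y - x) * (AiR Ai (x + u) * AiR Ai (y + u))) u := by
      intro u _
      have a0 := (airy_hasDerivAt Ai hAi (x + u)).comp_const_add x u
      have a1 := (airy_hasDerivAt2 Ai hAi (x + u)).comp_const_add x u
      have b0 := (airy_hasDerivAt Ai hAi (y + u)).comp_const_add y u
      have b1 := (airy_hasDerivAt2 Ai hAi (y + u)).comp_const_add y u
      refine ((a0.mul b1).sub (a1.mul b0)).congr_deriv ?_
      ring
    have ht : ∀ z : ℝ, Tendsto (fun u : ℝ => z + u) atTop atTop := fun z =>
      tendsto_atTop_add_const_left atTop z tendsto_id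
    have f0 := airy_tendsto Ai hAi
    have f1 := airy_deriv_tendsto Ai hAi
    have hl := ((f0.comp (ht x)).mul (f1.comp (ht y))).sub ((f1.comp (ht x)).mul (f0.comp (ht y)))
    simp only [mul_zero, sub_zero] at hl
    have h := integral_Ioi_of_hasDerivAt_of_tendsto' hd
      ((airy_integrable Ai hAi x y).const_mul (y - x)) hl
    rw [integral_const_mul] at h
    simp only [add_zero] at h
    rw [div_eq_iff (sub_ne_zero.2 hxy)]
    linarith
  · intro x
    have hd : ∀ u ∈ Ici (0:ℝ), HasDerivAt
        (fun u => deriv (AiR Ai) (x + u) ^ 2 - (x + u) * AiR Ai (x + u) ^ 2)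
        (-(AiR Ai (x + u) ^ 2)) u := fun u _ =>
      (airy_energy_deriv Ai hAi (x + u)).comp_const_add x u
    have hl := (airy_energy_tendsto Ai hAi).comp (tendsto_atTop_add_const_left atTop x tendsto_id)
    have hfi : IntegrableOn (fun u => -(AiR Ai (x + u) ^ 2)) (Ioi 0) := by
      refine (airy_integrable Ai hAi x x).neg.congr_fun (fun u _ => ?_) measurableSet_Ioi
      simp [sq]
    have h := integral_Ioi_of_hasDerivAt_of_tendsto' hd hfi hl
    rw [integral_neg] at h
    simp only [add_zero] at h
    linarith
end
end

section
/- There exist absolute constants L > 1, L₁ and C such that for every n and every integer k with 0 ≤ k ≤ (1+ε/4)n: |Q_k^{(n)}/Q_k^{(L,n)} − 1| ≤ C·e^{−nL₁} and |γ_k^{(n)}/γ_k^{(L,n)} − 1| ≤ C·e^{−nL₁}. -/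
open MeasureTheory Filter Set

noncomputable section
/-- `p` is the system of orthonormal polynomials for the weight `e^{-nV}` on the set `S`:
`p l` has degree `l`, positive leading coefficient, and the system is orthonormal. -/
def OrthonormalSystem (V : ℝ → ℝ) (n : ℕ) (S : Set ℝ) (p : ℕ → Polynomial ℝ) : Prop :=
  (∀ l, (p l).natDegree = l) ∧ (∀ l, 0 < (p l).leadingCoeff) ∧
    ∀ l m, (∫ x in S, (p l).eval x * (p m).eval x * Real.exp (-(n:ℝ) * V x)) =
      if l = m then 1 else 0

/-- The orthonormalized functions `ψ_l^{(n)} = e^{-nV/2} p_l^{(n)}`. -/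
def psiF (V : ℝ → ℝ) (n : ℕ) (p : ℕ → Polynomial ℝ) (l : ℕ) (x : ℝ) : ℝ :=
  Real.exp (-(n:ℝ) * V x / 2) * (p l).eval x

/-- The partition function `Q_k^{(n)}` over the set `S`. -/
def Qconst (V : ℝ → ℝ) (n k : ℕ) (S : Set ℝ) : ℝ :=
  ∫ μ in Set.pi Set.univ (fun _ : Fin k => S),
    ((∏ i : Fin k, ∏ j : Fin k, if i < j then (μ i - μ j) ^ 2 else 1) *
      ∏ i : Fin k, Real.exp (-(n:ℝ) * V (μ i)))

theorem U_bound (x : ℝ) (hx : 1 ≤ x) (m : ℕ) :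
    0 ≤ (Polynomial.Chebyshev.U ℝ m).eval x ∧
    (Polynomial.Chebyshev.U ℝ m).eval x ≤ (Polynomial.Chebyshev.U ℝ (m+1)).eval x ∧
    (Polynomial.Chebyshev.U ℝ m).eval x ≤ (2*x)^m ∧
    (Polynomial.Chebyshev.U ℝ (m+1)).eval x ≤ (2*x)^(m+1) := by
  induction m with
  | zero => simp; linarith
  | succ m ih =>
    obtain ⟨h0, h1, h2, h3⟩ := ih
    have e : (Polynomial.Chebyshev.U ℝ ((m:ℤ)+2)).eval x =
        2 * x * (Polynomial.Chebyshev.U ℝ ((m:ℤ)+1)).eval x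
          - (Polynomial.Chebyshev.U ℝ (m:ℤ)).eval x := by
      rw [Polynomial.Chebyshev.U_add_two]; simp
    have e2 : ((m:ℤ)+1+1) = (m:ℤ)+2 := by ring
    push_cast
    rw [e2, e]
    refine ⟨by linarith, by nlinarith, h3, ?_⟩
    have : 2 * x * (Polynomial.Chebyshev.U ℝ ((m:ℤ)+1)).eval x ≤ 2*x*(2*x)^(m+1) :=
      mul_le_mul_of_nonneg_left h3 (by linarith)
    rw [pow_succ (2*x) (m+1)]
    nlinarith

theorem exists_antideriv (R : Polynomial ℝ) :
    ∃ Q : Polynomial ℝ, Polynomial.derivative Q = R ∧ Q.natDegree ≤ R.natDegree + 1 := by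
  refine ⟨∑ i ∈ Finset.range (R.natDegree + 1),
    Polynomial.C (R.coeff i / (i+1)) * Polynomial.X ^ (i+1), ?_, ?_⟩
  · rw [Polynomial.derivative_sum]
    conv_rhs => rw [R.as_sum_range_C_mul_X_pow]
    refine Finset.sum_congr rfl fun i _ => ?_
    rw [Polynomial.derivative_C_mul_X_pow]
    congr 2
    push_cast
    have : (i:ℝ) + 1 ≠ 0 := by positivity
    field_simp
  · apply Polynomial.natDegree_sum_le_of_forall_le
    intro i hi
    have : i < R.natDegree + 1 := by simpa using hi
    exact (Polynomial.natDegree_C_mul_X_pow_le _ _).trans (by omega)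

theorem poly_growth_pos (P : Polynomial ℝ) (d : ℕ) (hd : P.natDegree ≤ d) (x : ℝ) (hx : 1 ≤ x) :
    (P.eval x)^2 ≤ (2*d+1) * (2*x)^(2*d) * ∫ t in (-1:ℝ)..1, (P.eval t)^2 := by
  set N := ∫ t in (-1:ℝ)..1, (P.eval t)^2 with hN
  have hc : 0 < (2*(d:ℝ)+1) * (2*x)^(2*d) := by positivity
  rw [← div_le_iff₀' hc]
  apply le_of_forall_gt_imp_ge_of_dense
  intro A hA
  have hN0 : 0 ≤ N := intervalIntegral.integral_nonneg (by norm_num) (fun t _ => sq_nonneg _)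
  have hA0 : 0 < A := lt_of_le_of_lt hN0 hA
  obtain ⟨Q, hQ, hQd⟩ := exists_antideriv (P^2)
  have hcont : Continuous (fun t => (P.eval t)^2) := by fun_prop
  have hFTC : ∀ a b : ℝ, ∫ t in a..b, (P.eval t)^2 = Q.eval b - Q.eval a := by
    intro a b
    apply intervalIntegral.integral_eq_sub_of_hasDerivAt
    · intro t _
      have := Q.hasDerivAt t
      rw [hQ] at this
      simpa using this
    · exact hcont.intervalIntegrable _ _
  have hb : ∀ y ∈ Icc (-1:ℝ) 1, |(Polynomial.C A⁻¹ * (Q - Polynomial.C (Q.eval (-1)))).eval y| ≤ 1 := by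
    intro y hy
    simp only [Polynomial.eval_mul, Polynomial.eval_C, Polynomial.eval_sub]
    rw [← hFTC]
    have h1 : 0 ≤ ∫ t in (-1:ℝ)..y, (P.eval t)^2 :=
      intervalIntegral.integral_nonneg hy.1 (fun t _ => sq_nonneg _)
    have h2 : 0 ≤ ∫ t in y..(1:ℝ), (P.eval t)^2 :=
      intervalIntegral.integral_nonneg hy.2 (fun t _ => sq_nonneg _)
    have h3 : (∫ t in (-1:ℝ)..y, (P.eval t)^2) + ∫ t in y..(1:ℝ), (P.eval t)^2 = N :=
      intervalIntegral.integral_add_adjacent_intervals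
        (hcont.intervalIntegrable _ _) (hcont.intervalIntegrable _ _)
    rw [abs_of_nonneg (by positivity), inv_mul_le_iff₀ hA0]
    linarith
  have hdeg : (Polynomial.C A⁻¹ * (Q - Polynomial.C (Q.eval (-1)))).degree ≤ ((2*d+1 : ℕ) : WithBot ℕ) := by
    apply Polynomial.degree_le_of_natDegree_le
    refine (Polynomial.natDegree_C_mul_le _ _).trans ?_
    refine (Polynomial.natDegree_sub_C).le.trans (hQd.trans ?_)
    have := Polynomial.natDegree_pow_le (p := P) (n := 2)
    omega
  have key := Polynomial.Chebyshev.eval_iterate_derivative_le_of_forall_abs_le_one (k := 1) hx hdeg hb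
  simp only [Function.iterate_one, Polynomial.derivative_mul, Polynomial.derivative_C,
    Polynomial.derivative_sub, hQ, zero_mul, zero_add, sub_zero, Polynomial.eval_mul,
    Polynomial.eval_C, Polynomial.eval_pow, Polynomial.Chebyshev.T_derivative_eq_U] at key
  have hU := (U_bound x hx (2*d)).2.2.1
  have e : (((2*d+1 : ℕ):ℤ) - 1) = ((2*d : ℕ):ℤ) := by push_cast; ring
  rw [e] at key
  have e3 : Polynomial.eval x ((((2*d+1 : ℕ):ℤ) : Polynomial ℝ)) = 2*(d:ℝ)+1 := by
    simp
  rw [e3, inv_mul_le_iff₀ hA0] at key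
  rw [div_le_iff₀' hc]
  refine key.trans ?_
  rw [mul_comm A]
  have : 0 ≤ (2*(d:ℝ)+1) := by positivity
  gcongr

theorem poly_growth (P : Polynomial ℝ) (d : ℕ) (hd : P.natDegree ≤ d) (x : ℝ) (hx : 1 ≤ |x|) :
    (P.eval x)^2 ≤ 16^d * |x|^(2*d) * ∫ t in (-1:ℝ)..1, (P.eval t)^2 := by
  have hN0 : 0 ≤ ∫ t in (-1:ℝ)..1, (P.eval t)^2 :=
    intervalIntegral.integral_nonneg (by norm_num) (fun t _ => sq_nonneg _)
  have h1 : (P.eval x)^2 ≤ (2*d+1) * (2*|x|)^(2*d) * ∫ t in (-1:ℝ)..1, (P.eval t)^2 := by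
    rcases le_total 0 x with h | h
    · rw [abs_of_nonneg h] at hx ⊢
      exact poly_growth_pos P d hd x hx
    · rw [abs_of_nonpos h] at hx ⊢
      have := poly_growth_pos (P.comp (-Polynomial.X)) d (by
        rw [Polynomial.natDegree_comp]; simpa using hd) (-x) hx
      simp only [Polynomial.eval_comp, Polynomial.eval_neg, Polynomial.eval_X, neg_neg] at this
      rw [intervalIntegral.integral_comp_neg (fun t => (P.eval t)^2)] at this
      simpa using this
  refine h1.trans (mul_le_mul_of_nonneg_right ?_ hN0)
  rw [mul_pow, ← mul_assoc]
  refine mul_le_mul_of_nonneg_right ?_ (by positivity)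
  rw [pow_mul (2:ℝ)]
  have : (2*(d:ℝ)+1) ≤ 4^d := by
    have := one_add_mul_le_pow (a := (3:ℝ)) (by norm_num) d
    norm_num at this
    have h0 : (0:ℝ) ≤ d := by positivity
    linarith
  calc (2*(d:ℝ)+1) * (2^2)^d ≤ 4^d * 4^d := by norm_num; gcongr
    _ = 16^d := by rw [← mul_pow]; norm_num

theorem tail_bound (V : ℝ → ℝ) (hVc : Continuous V) (ε M L : ℝ) (hε : 0 < ε)
    (hM : ∀ t ∈ Icc (-1:ℝ) 1, V t ≤ M)
    (hL : 1 < L) (hg : ∀ x : ℝ, L ≤ |x| → (2 + ε) * Real.log |x| ≤ V x)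
    (n d : ℕ) (hs : 2*(d:ℝ) + 2 + ε * n / 4 ≤ (2+ε) * n)
    (P : Polynomial ℝ) (hd : P.natDegree ≤ d) :
    ∫⁻ x, ENNReal.ofReal ((P.eval x)^2 * Real.exp (-(n:ℝ) * V x)) ≤
      ENNReal.ofReal (1 + 8 * 16^d * Real.exp (n * M) * Real.exp (-(ε * n / 4) * Real.log L)) *
        ∫⁻ x in Icc (-L) L, ENNReal.ofReal ((P.eval x)^2 * Real.exp (-(n:ℝ) * V x)) := by
  have hFc : Continuous (fun x => (P.eval x)^2 * Real.exp (-(n:ℝ) * V x)) := by fun_prop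
  have hF0 : ∀ x, 0 ≤ (P.eval x)^2 * Real.exp (-(n:ℝ) * V x) := fun x => by positivity
  set F : ℝ → ℝ := fun x => (P.eval x)^2 * Real.exp (-(n:ℝ) * V x) with hF
  set δ : ℝ := 8 * 16^d * Real.exp (n * M) * Real.exp (-(ε * n / 4) * Real.log L) with hδ
  have hδ0 : 0 ≤ δ := by positivity
  set B : ℝ := ∫ x in Icc (-L) L, F x with hB
  have hB0 : 0 ≤ B := integral_nonneg hF0
  have hBl : ∫⁻ x in Icc (-L) L, ENNReal.ofReal (F x) = ENNReal.ofReal B := by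
    rw [hB, ofReal_integral_eq_lintegral_ofReal]
    · exact hFc.continuousOn.integrableOn_Icc
    · exact Eventually.of_forall hF0
  set N := ∫ t in (-1:ℝ)..1, (P.eval t)^2 with hN
  have hNB : N ≤ Real.exp (n * M) * B := by
    have h1 : N = ∫ t in Icc (-1:ℝ) 1, (P.eval t)^2 := by
      rw [hN, intervalIntegral.integral_of_le (by norm_num), integral_Icc_eq_integral_Ioc]
    have h2 : ∫ t in Icc (-1:ℝ) 1, (P.eval t)^2 ≤ ∫ t in Icc (-1:ℝ) 1, Real.exp (n * M) * F t := by
      apply setIntegral_mono_on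
      · exact (by fun_prop : Continuous fun t => (P.eval t)^2).continuousOn.integrableOn_Icc
      · exact (by fun_prop : Continuous fun t => Real.exp (n * M) * F t).continuousOn.integrableOn_Icc
      · exact measurableSet_Icc
      · intro t ht
        have h3 : 1 ≤ Real.exp (n * M) * Real.exp (-(n:ℝ) * V t) := by
          rw [← Real.exp_add]
          apply Real.one_le_exp
          have := mul_le_mul_of_nonneg_left (hM t ht) (Nat.cast_nonneg (α := ℝ) n)
          linarith
        simp only [hF]
        nlinarith [sq_nonneg (P.eval t)]
    rw [integral_const_mul] at h2
    have h4 : ∫ t in Icc (-1:ℝ) 1, F t ≤ B := by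
      apply setIntegral_mono_set hFc.continuousOn.integrableOn_Icc (Eventually.of_forall hF0)
      exact (Icc_subset_Icc (by linarith) hL.le).eventuallyLE
    rw [h1]
    exact h2.trans (mul_le_mul_of_nonneg_left h4 (Real.exp_pos _).le)
  have hN0 : 0 ≤ N := intervalIntegral.integral_nonneg (by norm_num) (fun t _ => sq_nonneg _)
  rw [← lintegral_add_compl _ (measurableSet_Icc (a := -L) (b := L))]
  rw [hBl]
  rw [ENNReal.ofReal_add zero_le_one hδ0, add_mul, ENNReal.ofReal_one, one_mul]
  refine add_le_add le_rfl ?_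
  have hpt : ∀ x ∈ (Icc (-L) L)ᶜ, F x ≤
      (2 * 16^d * Real.exp (-(ε * n / 4) * Real.log L) * N) * (1 + x^2)⁻¹ := by
    intro x hx
    have hx' : L < |x| := by
      by_contra h
      exact hx (abs_le.mp (not_lt.mp h))
    have hx1 : 1 ≤ |x| := by linarith
    have hx0 : 0 < |x| := by linarith
    have g := poly_growth P d hd x hx1
    have hl0 : 0 ≤ Real.log L := Real.log_nonneg hL.le
    have hll : Real.log L ≤ Real.log |x| := Real.log_le_log (by linarith) hx'.le
    have hw : Real.exp (-(n:ℝ) * V x) ≤ Real.exp (-(n:ℝ) * ((2+ε) * Real.log |x|)) := by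
      apply Real.exp_le_exp.mpr
      have := mul_le_mul_of_nonneg_left (hg x hx'.le) (Nat.cast_nonneg (α := ℝ) n)
      linarith
    have hp : |x|^(2*d) = Real.exp ((2*d) * Real.log |x|) := by
      rw [mul_comm (2 * (d:ℝ)), ← Real.rpow_def_of_pos hx0]
      exact_mod_cast (Real.rpow_natCast |x| (2*d)).symm
    have hcomb : |x|^(2*d) * Real.exp (-(n:ℝ) * V x) ≤
        Real.exp (-(ε * n / 4) * Real.log L) * (2 * (1+x^2)⁻¹) := by
      have hq : Real.exp (-2 * Real.log |x|) ≤ 2 * (1+x^2)⁻¹ := by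
        have : Real.exp (-2 * Real.log |x|) = (x^2)⁻¹ := by
          rw [show -2 * Real.log |x| = -(Real.log |x| + Real.log |x|) by ring, Real.exp_neg,
            Real.exp_add, Real.exp_log hx0, ← sq, sq_abs]
        rw [this]
        have hx2 : 1 ≤ x^2 := by rw [← sq_abs]; nlinarith
        rw [← div_eq_mul_inv, inv_eq_one_div, div_le_div_iff₀ (by linarith) (by linarith)]
        linarith
      calc |x|^(2*d) * Real.exp (-(n:ℝ) * V x)
          ≤ Real.exp ((2*d) * Real.log |x|) * Real.exp (-(n:ℝ) * ((2+ε) * Real.log |x|)) := by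
            rw [hp]; gcongr
        _ ≤ Real.exp (-(ε * n / 4) * Real.log L) * Real.exp (-2 * Real.log |x|) := by
            rw [← Real.exp_add, ← Real.exp_add]
            apply Real.exp_le_exp.mpr
            have a1 := mul_le_mul_of_nonneg_right hs (hl0.trans hll)
            have a2 : (ε * n / 4) * Real.log L ≤ (ε * n / 4) * Real.log |x| :=
              mul_le_mul_of_nonneg_left hll (by positivity)
            nlinarith
        _ ≤ _ := by gcongr
    calc F x ≤ (16^d * |x|^(2*d) * N) * Real.exp (-(n:ℝ) * V x) := by
          simp only [hF]; gcongr
      _ = (16^d * N) * (|x|^(2*d) * Real.exp (-(n:ℝ) * V x)) := by ring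
      _ ≤ (16^d * N) * (Real.exp (-(ε * n / 4) * Real.log L) * (2 * (1+x^2)⁻¹)) := by gcongr
      _ = _ := by ring
  set c : ℝ := 2 * 16^d * Real.exp (-(ε * n / 4) * Real.log L) * N with hc
  have hc0 : 0 ≤ c := by positivity
  calc ∫⁻ x in (Icc (-L) L)ᶜ, ENNReal.ofReal (F x)
      ≤ ∫⁻ x in (Icc (-L) L)ᶜ, ENNReal.ofReal (c * (1 + x^2)⁻¹) :=
        setLIntegral_mono' measurableSet_Icc.compl
          fun x hx => ENNReal.ofReal_le_ofReal (hpt x hx)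
    _ ≤ ∫⁻ x, ENNReal.ofReal (c * (1 + x^2)⁻¹) := setLIntegral_le_lintegral _ _
    _ = ENNReal.ofReal (c * Real.pi) := by
        rw [← ofReal_integral_eq_lintegral_ofReal (integrable_inv_one_add_sq.const_mul c)
          (Eventually.of_forall fun x => by positivity), integral_const_mul,
          integral_univ_inv_one_add_sq]
    _ ≤ ENNReal.ofReal (δ * B) := by
        apply ENNReal.ofReal_le_ofReal
        calc c * Real.pi ≤ c * 4 := by gcongr; exact Real.pi_le_four
          _ = 8 * 16^d * Real.exp (-(ε * n / 4) * Real.log L) * N := by rw [hc]; ring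
          _ ≤ 8 * 16^d * Real.exp (-(ε * n / 4) * Real.log L) * (Real.exp (n * M) * B) := by gcongr
          _ = δ * B := by rw [hδ]; ring
    _ = _ := ENNReal.ofReal_mul hδ0

theorem pi_compare (μ ν : Measure ℝ) [SigmaFinite μ] [SigmaFinite ν] (c : ENNReal) (k : ℕ)
    (F : (Fin k → ℝ) → ENNReal) (hF : Measurable F)
    (h : ∀ (i : Fin k) (x : Fin k → ℝ),
      ∫⁻ t, F (Function.update x i t) ∂μ ≤ c * ∫⁻ t, F (Function.update x i t) ∂ν) :
    ∫⁻ x, F x ∂(Measure.pi fun _ => μ) ≤ c^k * ∫⁻ x, F x ∂(Measure.pi fun _ => ν) := by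
  induction k with
  | zero =>
    rw [Measure.pi_of_empty (fun _ : Fin 0 => μ) 0, Measure.pi_of_empty (fun _ : Fin 0 => ν) 0]
    simp
  | succ k ih =>
    have split : ∀ (m : Measure ℝ) [SigmaFinite m],
        ∫⁻ x, F x ∂(Measure.pi fun _ : Fin (k+1) => m) =
          ∫⁻ z, F (Fin.cons z.1 z.2) ∂(m.prod (Measure.pi fun _ : Fin k => m)) := by
      intro m _
      have := (measurePreserving_piFinSuccAbove (fun _ : Fin (k+1) => m) 0).symm
      rw [← this.lintegral_comp hF]
      refine lintegral_congr fun z => ?_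
      congr 1
      simp [MeasurableEquiv.piFinSuccAbove, Fin.insertNthEquiv]
    have hcons : Measurable fun z : ℝ × (Fin k → ℝ) => (Fin.cons z.1 z.2 : Fin (k+1) → ℝ) := by
      rw [measurable_pi_iff]
      intro a
      refine Fin.cases ?_ (fun j => ?_) a
      · simpa using measurable_fst
      · simp only [Fin.cons_succ]; fun_prop
    have hG : Measurable fun z : ℝ × (Fin k → ℝ) => F (Fin.cons z.1 z.2) := hF.comp hcons
    rw [split μ, split ν, lintegral_prod _ hG.aemeasurable, lintegral_prod_symm _ hG.aemeasurable]
    calc ∫⁻ t, ∫⁻ y, F (Fin.cons t y) ∂(Measure.pi fun _ => μ) ∂μ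
        ≤ ∫⁻ t, c^k * ∫⁻ y, F (Fin.cons t y) ∂(Measure.pi fun _ => ν) ∂μ := by
          apply lintegral_mono
          intro t
          apply ih (fun y => F (Fin.cons t y)) (hG.comp measurable_prodMk_left)
          intro i x
          have := h i.succ (Fin.cons t x)
          simpa only [Fin.cons_update] using this
      _ = c^k * ∫⁻ y, ∫⁻ t, F (Fin.cons t y) ∂μ ∂(Measure.pi fun _ => ν) := by
          rw [lintegral_const_mul _ hG.lintegral_prod_right']
          rw [lintegral_lintegral_swap hG.aemeasurable]
      _ ≤ c^k * ∫⁻ y, c * ∫⁻ t, F (Fin.cons t y) ∂ν ∂(Measure.pi fun _ => ν) := by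
          gcongr with y
          have := h 0 (Fin.cons 0 y)
          simpa only [Fin.update_cons_zero] using this
      _ = _ := by
          rw [lintegral_const_mul _ hG.lintegral_prod_left', ← mul_assoc, pow_succ]

theorem slice_poly (V : ℝ → ℝ) (n k : ℕ) (i : Fin k) (x : Fin k → ℝ) :
    ∃ (P : Polynomial ℝ) (a : ℝ), 0 ≤ a ∧ P.natDegree ≤ k - 1 ∧ ∀ t : ℝ,
      ((∏ a : Fin k, ∏ b : Fin k, if a < b then
          (Function.update x i t a - Function.update x i t b) ^ 2 else 1) *
        ∏ a : Fin k, Real.exp (-(n:ℝ) * V (Function.update x i t a))) =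
        a * ((P.eval t)^2 * Real.exp (-(n:ℝ) * V t)) := by
  let u : Fin k → Polynomial ℝ := fun a => if a = i then Polynomial.X else Polynomial.C (x a)
  refine ⟨∏ a : Fin k, ∏ b : Fin k, if a < b then u a - u b else 1,
    ∏ a ∈ Finset.univ.erase i, Real.exp (-(n:ℝ) * V (x a)), ?_, ?_, ?_⟩
  · exact Finset.prod_nonneg fun _ _ => (Real.exp_pos _).le
  · have hb : ∀ a b : Fin k, (if a < b then u a - u b else 1).natDegree ≤
        (if a = i then (if i < b then 1 else 0) else 0) +
        (if b = i then (if a < i then 1 else 0) else 0) := by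
      intro a b
      by_cases hab : a < b
      · rw [if_pos hab]
        by_cases ha : a = i
        · have hb : b ≠ i := fun h => by rw [ha, h] at hab; exact lt_irrefl _ hab
          subst ha
          simp only [u, if_pos rfl, if_neg hb, if_pos hab]
          simp
        · by_cases hb : b = i
          · subst hb
            simp only [u, if_pos rfl, if_neg ha, if_pos hab]
            rw [← neg_sub, Polynomial.natDegree_neg]
            simp
          · simp only [u, if_neg ha, if_neg hb, ← Polynomial.C_sub, Polynomial.natDegree_C]
            simp
      · rw [if_neg hab]; simp
    refine (Polynomial.natDegree_prod_le _ _).trans ?_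
    refine (Finset.sum_le_sum fun a _ => (Polynomial.natDegree_prod_le _ _).trans
      (Finset.sum_le_sum fun b _ => hb a b)).trans ?_
    have e1 : ∑ a : Fin k, ∑ b : Fin k, (if a = i then (if i < b then 1 else 0) else 0) =
        k - 1 - i := by
      rw [Finset.sum_comm]
      simp only [Finset.sum_ite_eq', Finset.mem_univ, if_true]
      rw [← Finset.card_filter, ← Fin.card_Ioi]
      congr 1; ext; simp
    have e2 : ∑ a : Fin k, ∑ b : Fin k, (if b = i then (if a < i then 1 else 0) else 0) =
        (i:ℕ) := by
      simp only [Finset.sum_ite_eq', Finset.mem_univ, if_true]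
      rw [← Finset.card_filter, ← Fin.card_Iio]
      congr 1; ext; simp
    simp only [Finset.sum_add_distrib]
    rw [e1, e2]
    have := i.2
    omega
  · intro t
    have hu : ∀ a, (u a).eval t = Function.update x i t a := by
      intro a
      by_cases ha : a = i
      · subst ha; simp [u]
      · simp [u, ha]
    have h1 : ((∏ a : Fin k, ∏ b : Fin k, if a < b then u a - u b else 1).eval t)^2 =
        ∏ a : Fin k, ∏ b : Fin k, if a < b then
          (Function.update x i t a - Function.update x i t b) ^ 2 else 1 := by
      rw [Polynomial.eval_prod, ← Finset.prod_pow]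
      refine Finset.prod_congr rfl fun a _ => ?_
      rw [Polynomial.eval_prod, ← Finset.prod_pow]
      refine Finset.prod_congr rfl fun b _ => ?_
      split_ifs
      · rw [Polynomial.eval_sub, hu, hu]
      · simp
    rw [h1, ← Finset.mul_prod_erase Finset.univ
      (fun a => Real.exp (-(n:ℝ) * V (Function.update x i t a))) (Finset.mem_univ i)]
    have h2 : ∏ a ∈ Finset.univ.erase i, Real.exp (-(n:ℝ) * V (Function.update x i t a)) =
        ∏ a ∈ Finset.univ.erase i, Real.exp (-(n:ℝ) * V (x a)) := by
      refine Finset.prod_congr rfl fun a ha => ?_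
      rw [Function.update_of_ne (Finset.ne_of_mem_erase ha)]
    rw [h2, Function.update_self]
    ring

theorem Q_bound (V : ℝ → ℝ) (hVc : Continuous V) (L c : ℝ) (hL : 1 < L) (hc : 1 ≤ c) (n k : ℕ)
    (H : 0 < k → ∀ P : Polynomial ℝ, P.natDegree ≤ k - 1 →
      ∫⁻ x, ENNReal.ofReal ((P.eval x)^2 * Real.exp (-(n:ℝ) * V x)) ≤ ENNReal.ofReal c *
        ∫⁻ x in Icc (-L) L, ENNReal.ofReal ((P.eval x)^2 * Real.exp (-(n:ℝ) * V x))) :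
    |Qconst V n k Set.univ / Qconst V n k (Icc (-L) L) - 1| ≤ c^k - 1 := by
  let G : (Fin k → ℝ) → ℝ := fun μ =>
    ((∏ i : Fin k, ∏ j : Fin k, if i < j then (μ i - μ j) ^ 2 else 1) *
      ∏ i : Fin k, Real.exp (-(n:ℝ) * V (μ i)))
  have hGc : Continuous G := by
    refine Continuous.mul ?_ (by fun_prop)
    refine continuous_finsetProd _ fun i _ => continuous_finsetProd _ fun j _ => ?_
    split_ifs <;> fun_prop
  have hG0 : ∀ μ, 0 ≤ G μ := fun μ => by
    refine mul_nonneg (Finset.prod_nonneg fun i _ => Finset.prod_nonneg fun j _ => ?_)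
      (Finset.prod_nonneg fun _ _ => (Real.exp_pos _).le)
    split_ifs <;> positivity
  have hQ : ∀ S : Set ℝ, Qconst V n k S =
      (∫⁻ μ, ENNReal.ofReal (G μ) ∂(Measure.pi fun _ => (volume : Measure ℝ).restrict S)).toReal := by
    intro S
    rw [Qconst, volume_pi, Measure.restrict_pi_pi]
    exact integral_eq_lintegral_of_nonneg_ae (Eventually.of_forall hG0)
      hGc.aestronglyMeasurable
  set A := ∫⁻ μ, ENNReal.ofReal (G μ) ∂(Measure.pi fun _ : Fin k => (volume : Measure ℝ).restrict univ) with hA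
  set B := ∫⁻ μ, ENNReal.ofReal (G μ) ∂(Measure.pi fun _ : Fin k => (volume : Measure ℝ).restrict (Icc (-L) L)) with hB
  have hmeas : Measurable fun μ => ENNReal.ofReal (G μ) := hGc.measurable.ennreal_ofReal
  have hAB : A ≤ ENNReal.ofReal c ^ k * B := by
    apply pi_compare _ _ _ _ _ hmeas
    intro i x
    obtain ⟨P, a, ha, hP, hG⟩ := slice_poly V n k i x
    have hGe : ∀ t, ENNReal.ofReal (G (Function.update x i t)) =
        ENNReal.ofReal a * ENNReal.ofReal ((P.eval t)^2 * Real.exp (-(n:ℝ) * V t)) := by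
      intro t
      rw [← ENNReal.ofReal_mul ha, ← hG t]
    simp only [hGe]
    have hm : Measurable fun t => ENNReal.ofReal ((P.eval t)^2 * Real.exp (-(n:ℝ) * V t)) :=
      (by fun_prop : Continuous fun t => (P.eval t)^2 * Real.exp (-(n:ℝ) * V t)).measurable.ennreal_ofReal
    rw [lintegral_const_mul _ hm, lintegral_const_mul _ hm, mul_left_comm, Measure.restrict_univ]
    gcongr
    exact H (Fin.pos i) P hP
  have hBA : B ≤ A := by
    rw [hA, hB, ← Measure.restrict_pi_pi, ← Measure.restrict_pi_pi]
    exact lintegral_mono_set (Set.pi_mono fun _ _ => subset_univ _)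
  have hBfin : B ≠ ⊤ := by
    rw [hB, ← Measure.restrict_pi_pi]
    have : IntegrableOn G (Set.pi univ fun _ : Fin k => Icc (-L) L)
        (Measure.pi fun _ : Fin k => (volume : Measure ℝ)) :=
      hGc.continuousOn.integrableOn_compact (isCompact_univ_pi fun _ => isCompact_Icc)
    rw [← ofReal_integral_eq_lintegral_ofReal this (Eventually.of_forall hG0)]
    exact ENNReal.ofReal_ne_top
  have hBpos : 0 < B := by
    rw [hB, ← Measure.restrict_pi_pi, lintegral_pos_iff_support hmeas]
    have hop : IsOpen ((G ⁻¹' Ioi 0) ∩ Set.pi univ fun _ : Fin k => Ioo (-L) L) :=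
      (isOpen_Ioi.preimage hGc).inter (isOpen_set_pi finite_univ fun _ _ => isOpen_Ioo)
    have hne : ((G ⁻¹' Ioi 0) ∩ Set.pi univ fun _ : Fin k => Ioo (-L) L).Nonempty := by
      refine ⟨fun i => (i:ℝ) / k, ?_, ?_⟩
      · show 0 < G _
        refine mul_pos (Finset.prod_pos fun i _ => Finset.prod_pos fun j _ => ?_)
          (Finset.prod_pos fun _ _ => Real.exp_pos _)
        split_ifs with hij
        · have hk : (0:ℝ) < k := by exact_mod_cast Fin.pos i
          have : (i:ℝ)/k < (j:ℝ)/k := by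
            apply div_lt_div_of_pos_right _ hk
            exact_mod_cast hij
          have : (i:ℝ)/k - (j:ℝ)/k ≠ 0 := by linarith
          positivity
        · norm_num
      · intro i _
        have hk : (0:ℝ) < k := by exact_mod_cast Fin.pos i
        have h1 : (0:ℝ) ≤ (i:ℝ)/k := by positivity
        have h2 : (i:ℝ)/k < 1 := by
          rw [div_lt_one hk]; exact_mod_cast i.2
        exact ⟨by linarith, by linarith⟩
    have hp := hop.measure_pos (Measure.pi fun _ : Fin k => (volume : Measure ℝ)) hne
    refine hp.trans_le ?_
    refine le_trans ?_ (Measure.le_restrict_apply _ _)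
    apply measure_mono
    rintro μ ⟨h1, h2⟩
    refine ⟨?_, fun i hi => Ioo_subset_Icc_self (h2 i hi)⟩
    simpa using h1
  have hAfin : A ≠ ⊤ := ne_top_of_le_ne_top
    (ENNReal.mul_ne_top (ENNReal.pow_ne_top ENNReal.ofReal_ne_top) hBfin) hAB
  rw [hQ, hQ]
  have hb : 0 < B.toReal := ENNReal.toReal_pos hBpos.ne' hBfin
  have h1 : B.toReal ≤ A.toReal := ENNReal.toReal_mono hAfin hBA
  have h2 : A.toReal ≤ c^k * B.toReal := by
    have := ENNReal.toReal_mono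
      (ENNReal.mul_ne_top (ENNReal.pow_ne_top ENNReal.ofReal_ne_top) hBfin) hAB
    rwa [ENNReal.toReal_mul, ENNReal.toReal_pow, ENNReal.toReal_ofReal (by linarith)] at this
  have h3 : 1 ≤ A.toReal / B.toReal := by rwa [le_div_iff₀ hb, one_mul]
  have h4 : A.toReal / B.toReal ≤ c^k := by rwa [div_le_iff₀ hb]
  rw [abs_of_nonneg (by linarith)]
  linarith

/-- Extremal property of orthonormal polynomials. -/
theorem op_extremal (V : ℝ → ℝ) (hVc : Continuous V) (n : ℕ) (S : Set ℝ) (p : ℕ → Polynomial ℝ)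
    (hp : OrthonormalSystem V n S p) (k : ℕ) (q : Polynomial ℝ) (hq : q.natDegree ≤ k) :
    IntegrableOn (fun x => (q.eval x)^2 * Real.exp (-(n:ℝ) * V x)) S ∧
    (q.coeff k / (p k).leadingCoeff)^2 ≤
      ∫ x in S, (q.eval x)^2 * Real.exp (-(n:ℝ) * V x) := by
  obtain ⟨hdeg, hlc, hort⟩ := hp
  let w : ℝ → ℝ := fun x => Real.exp (-(n:ℝ) * V x)
  have hw : Continuous w := by fun_prop
  have hw0 : ∀ x, 0 < w x := fun x => Real.exp_pos _
  -- decomposition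
  have dec : ∀ (m : ℕ) (r : Polynomial ℝ), r.natDegree ≤ m → ∃ s : Polynomial ℝ,
      r = Polynomial.C (r.coeff m / (p m).leadingCoeff) * p m + s ∧
      (s = 0 ∨ s.natDegree < m) := by
    intro m r hr
    refine ⟨r - Polynomial.C (r.coeff m / (p m).leadingCoeff) * p m, by ring, ?_⟩
    set s := r - Polynomial.C (r.coeff m / (p m).leadingCoeff) * p m with hs
    have hsd : s.natDegree ≤ m := by
      refine (Polynomial.natDegree_sub_le _ _).trans (max_le hr ?_)
      exact (Polynomial.natDegree_C_mul_le _ _).trans (hdeg m).le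
    have hsc : s.coeff m = 0 := by
      rw [hs, Polynomial.coeff_sub, Polynomial.coeff_C_mul]
      have : (p m).coeff m = (p m).leadingCoeff := by
        rw [Polynomial.leadingCoeff, hdeg]
      rw [this, div_mul_cancel₀ _ (hlc m).ne', sub_self]
    by_cases h0 : s = 0
    · exact Or.inl h0
    · right
      refine lt_of_le_of_ne hsd fun h => h0 ?_
      rw [← Polynomial.leadingCoeff_eq_zero, Polynomial.leadingCoeff, h, hsc]
  have hsq : ∀ m, IntegrableOn (fun x => (p m).eval x * (p m).eval x * w x) S := by
    intro m
    by_contra h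
    have := hort m m
    rw [if_pos rfl, integral_undef h] at this
    exact zero_ne_one this
  have hmul : ∀ l m, IntegrableOn (fun x => (p l).eval x * (p m).eval x * w x) S := by
    intro l m
    refine Integrable.mono' ((hsq l).add (hsq m)) ?_ (Eventually.of_forall fun x => ?_)
    · exact (by fun_prop : Continuous fun x =>
        (p l).eval x * (p m).eval x * w x).aestronglyMeasurable
    · simp only [Pi.add_apply, Real.norm_eq_abs]
      rw [abs_mul, abs_of_pos (hw0 x), ← add_mul]
      refine mul_le_mul_of_nonneg_right ?_ (hw0 x).le
      rw [abs_le]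
      constructor <;> nlinarith [sq_nonneg ((p l).eval x + (p m).eval x),
        sq_nonneg ((p l).eval x - (p m).eval x), sq_nonneg ((p l).eval x), sq_nonneg ((p m).eval x)]
  -- integrability of r * p l * w and orthogonality
  have hrp : ∀ (m : ℕ) (r : Polynomial ℝ), r.natDegree ≤ m → ∀ l,
      IntegrableOn (fun x => r.eval x * (p l).eval x * w x) S ∧
      (m < l → ∫ x in S, r.eval x * (p l).eval x * w x = 0) := by
    intro m
    induction m using Nat.strong_induction_on with
    | _ m ih =>
      intro r hr l
      obtain ⟨s, hrs, hs⟩ := dec m r hr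
      set a := r.coeff m / (p m).leadingCoeff with ha
      have hsI : IntegrableOn (fun x => s.eval x * (p l).eval x * w x) S ∧
          (m < l → ∫ x in S, s.eval x * (p l).eval x * w x = 0) := by
        rcases hs with rfl | hs
        · simp
        · exact ⟨(ih _ hs s le_rfl l).1, fun h => (ih _ hs s le_rfl l).2 (hs.trans h)⟩
      have e : (fun x => r.eval x * (p l).eval x * w x) = fun x =>
          a * ((p m).eval x * (p l).eval x * w x) + s.eval x * (p l).eval x * w x := by
        funext x
        conv_lhs => rw [hrs]
        simp only [Polynomial.eval_add, Polynomial.eval_mul, Polynomial.eval_C]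
        ring
      rw [e]
      have i1 : IntegrableOn (fun x => a * ((p m).eval x * (p l).eval x * w x)) S :=
        (hmul m l).const_mul a
      refine ⟨i1.add hsI.1, fun h => ?_⟩
      rw [integral_add i1 hsI.1, integral_const_mul, hsI.2 h]
      have := hort m l
      rw [if_neg h.ne] at this
      simp only [w]
      rw [this]; ring
  have hrr : ∀ (m : ℕ) (r q : Polynomial ℝ), r.natDegree ≤ m →
      IntegrableOn (fun x => r.eval x * q.eval x * w x) S := by
    intro m
    induction m using Nat.strong_induction_on with
    | _ m ih =>
      intro r q hr
      obtain ⟨s, hrs, hs⟩ := dec m r hr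
      set a := r.coeff m / (p m).leadingCoeff with ha
      have hsI : IntegrableOn (fun x => s.eval x * q.eval x * w x) S := by
        rcases hs with rfl | hs
        · simp
        · exact ih _ hs s q le_rfl
      have e : (fun x => r.eval x * q.eval x * w x) = fun x =>
          a * (q.eval x * (p m).eval x * w x) + s.eval x * q.eval x * w x := by
        funext x
        conv_lhs => rw [hrs]
        simp only [Polynomial.eval_add, Polynomial.eval_mul, Polynomial.eval_C]
        ring
      rw [e]
      exact ((hrp _ q le_rfl m).1.const_mul a).add hsI
  have hint : ∀ r : Polynomial ℝ, IntegrableOn (fun x => (r.eval x)^2 * w x) S := by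
    intro r
    have := hrr _ r r le_rfl
    simpa only [sq] using this
  refine ⟨hint q, ?_⟩
  obtain ⟨s, hqs, hs⟩ := dec k q hq
  set a := q.coeff k / (p k).leadingCoeff with ha
  have hsI : IntegrableOn (fun x => s.eval x * (p k).eval x * w x) S := (hrp _ s le_rfl k).1
  have hs0 : ∫ x in S, s.eval x * (p k).eval x * w x = 0 := by
    rcases hs with rfl | hs
    · simp
    · exact (hrp _ s le_rfl k).2 hs
  have e : (fun x => (q.eval x)^2 * w x) = fun x =>
      (a^2 * ((p k).eval x * (p k).eval x * w x) + (2*a) * (s.eval x * (p k).eval x * w x))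
        + (s.eval x)^2 * w x := by
    funext x
    conv_lhs => rw [hqs]
    simp only [Polynomial.eval_add, Polynomial.eval_mul, Polynomial.eval_C]
    ring
  show a^2 ≤ ∫ x in S, (q.eval x)^2 * w x
  rw [e]
  have i1 := (hsq k).const_mul (a^2)
  have i2 := hsI.const_mul (2*a)
  have i12 : Integrable (fun x => a^2 * ((p k).eval x * (p k).eval x * w x) +
      (2*a) * (s.eval x * (p k).eval x * w x)) (volume.restrict S) := i1.add i2
  rw [integral_add i12 (hint s), integral_add i1 i2, integral_const_mul,
    integral_const_mul, hs0]
  have h1 := hort k k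
  rw [if_pos rfl] at h1
  have h2 : 0 ≤ ∫ x in S, (s.eval x)^2 * w x :=
    integral_nonneg fun x => mul_nonneg (sq_nonneg _) (hw0 x).le
  simp only [w] at h1 h2 ⊢
  rw [h1]
  linarith

theorem continuous_of_holder (V : ℝ → ℝ)
    (hholder : ∀ L₂ : ℝ, ∃ C : ℝ, ∃ γ₀ > (0:ℝ), ∀ x y : ℝ, |x| ≤ L₂ → |y| ≤ L₂ →
      |V x - V y| ≤ C * |x - y| ^ γ₀) : Continuous V := by
  rw [continuous_iff_continuousAt]
  intro x
  obtain ⟨C, γ, hγ, h⟩ := hholder (|x| + 1)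
  rw [ContinuousAt, tendsto_iff_dist_tendsto_zero]
  have h1 : Tendsto (fun y => C * |y - x| ^ γ) (nhds x) (nhds 0) := by
    have hc : Continuous fun y => C * |y - x| ^ γ := by
      refine continuous_const.mul ?_
      exact (by fun_prop : Continuous fun y => |y - x|).rpow_const fun _ => Or.inr hγ.le
    have := hc.tendsto x
    simpa [Real.zero_rpow hγ.ne'] using this
  refine squeeze_zero' (Eventually.of_forall fun y => dist_nonneg) ?_ h1
  filter_upwards [Metric.ball_mem_nhds x one_pos] with y hy
  rw [Real.dist_eq]
  rw [Metric.mem_ball, Real.dist_eq] at hy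
  refine h y x ?_ (by linarith)
  have := abs_add_le (y - x) x
  rw [sub_add_cancel] at this
  linarith

theorem partition_function_truncation
    (V : ℝ → ℝ) (hV0 : ∀ x, 0 ≤ V x)
    (ε L₁' : ℝ) (hε : 0 < ε)
    (hgrowth : ∀ x : ℝ, L₁' ≤ |x| → (2 + ε) * Real.log |x| ≤ |V x|)
    (hholder : ∀ L₂ : ℝ, ∃ C : ℝ, ∃ γ₀ > (0:ℝ), ∀ x y : ℝ, |x| ≤ L₂ → |y| ≤ L₂ →
      |V x - V y| ≤ C * |x - y| ^ γ₀) :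
    ∃ L : ℝ, 1 < L ∧ ∃ L₁ C : ℝ, 0 < L₁ ∧ 0 < C ∧
      ∀ (n k : ℕ), (k : ℝ) ≤ (1 + ε/4) * n →
        |Qconst V n k Set.univ / Qconst V n k (Icc (-L) L) - 1| ≤
            C * Real.exp (-(n:ℝ) * L₁) ∧
          ∀ (p pL : ℕ → Polynomial ℝ),
            OrthonormalSystem V n Set.univ p → OrthonormalSystem V n (Icc (-L) L) pL →
            |(p k).leadingCoeff / (pL k).leadingCoeff - 1| ≤ C * Real.exp (-(n:ℝ) * L₁) := by
  have hVc := continuous_of_holder V hholder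
  obtain ⟨M, hM⟩ := (isCompact_Icc (a := (-1:ℝ)) (b := 1)).bddAbove_image hVc.continuousOn
  have hM' : ∀ t ∈ Icc (-1:ℝ) 1, V t ≤ M := fun t ht => hM (mem_image_of_mem V ht)
  set κ : ℝ := 1 + ε/4 with hκ
  have hκ0 : 0 < κ := by positivity
  set L : ℝ := max (max L₁' 2) (Real.exp ((4/ε) * (M + 3*κ + 2))) with hLdef
  have hL : 1 < L := lt_of_lt_of_le one_lt_two ((le_max_right _ _).trans (le_max_left _ _))
  have hLL : L₁' ≤ L := (le_max_left _ _).trans (le_max_left _ _)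
  have hlog : (4/ε) * (M + 3*κ + 2) ≤ Real.log L := by
    rw [Real.le_log_iff_exp_le (by linarith)]
    exact le_max_right _ _
  have hlog' : M + 3*κ + 2 ≤ (ε/4) * Real.log L := by
    have := mul_le_mul_of_nonneg_left hlog (by positivity : 0 ≤ ε/4)
    rw [← mul_assoc] at this
    have e : ε/4 * (4/ε) = 1 := by field_simp
    rwa [e, one_mul] at this
  have hg : ∀ x : ℝ, L ≤ |x| → (2 + ε) * Real.log |x| ≤ V x := by
    intro x hx
    have := hgrowth x (hLL.trans hx)
    rwa [abs_of_nonneg (hV0 x)] at this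
  have H : ∀ n d : ℕ, (d:ℝ) ≤ κ * n → 2*(d:ℝ) + 2 + ε * n / 4 ≤ (2+ε) * n →
      ∀ P : Polynomial ℝ, P.natDegree ≤ d →
      ∫⁻ x, ENNReal.ofReal ((P.eval x)^2 * Real.exp (-(n:ℝ) * V x)) ≤
        ENNReal.ofReal (1 + 8 * Real.exp (-2 * n)) *
        ∫⁻ x in Icc (-L) L, ENNReal.ofReal ((P.eval x)^2 * Real.exp (-(n:ℝ) * V x)) := by
    intro n d hdn hs P hP
    refine (tail_bound V hVc ε M L hε hM' hL hg n d hs P hP).trans ?_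
    gcongr ENNReal.ofReal (1 + ?_) * _
    have h16 : (16:ℝ)^d ≤ Real.exp (3 * κ * n) := by
      have h3 : (16:ℝ) ≤ Real.exp 3 := by
        have := Real.exp_one_gt_d9
        have e : Real.exp 3 = Real.exp 1 ^ 3 := by rw [← Real.exp_nat_mul]; norm_num
        rw [e]
        calc (16:ℝ) ≤ 2.7^3 := by norm_num
          _ ≤ _ := by gcongr; linarith
      calc (16:ℝ)^d ≤ Real.exp 3 ^ d := by gcongr
        _ = Real.exp (d * 3) := by rw [← Real.exp_nat_mul]
        _ ≤ _ := Real.exp_le_exp.mpr (by linarith)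
    calc 8 * 16^d * Real.exp (n * M) * Real.exp (-(ε * n / 4) * Real.log L)
        ≤ 8 * Real.exp (3 * κ * n) * Real.exp (n * M) * Real.exp (-(ε * n / 4) * Real.log L) := by
          gcongr
      _ = 8 * Real.exp (3 * κ * n + n * M + -(ε * n / 4) * Real.log L) := by
          rw [Real.exp_add, Real.exp_add]; ring
      _ ≤ 8 * Real.exp (-2 * n) := by
          gcongr
          have := mul_le_mul_of_nonneg_left hlog' (Nat.cast_nonneg (α := ℝ) n)
          linarith
  refine ⟨L, hL, 1, 8*κ*Real.exp (8*κ) + Real.exp (8/ε) + 8, one_pos, by positivity, ?_⟩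
  intro n k hkn
  have hn0 : (0:ℝ) ≤ n := Nat.cast_nonneg n
  have hen : Real.exp (-(n:ℝ) * 1) = Real.exp (-(n:ℝ)) := by rw [mul_one]
  rw [hen]
  have hE : 0 < Real.exp (-(n:ℝ)) := Real.exp_pos _
  have hE1 : Real.exp (-(n:ℝ)) ≤ 1 := Real.exp_le_one_iff.mpr (by linarith)
  have hE2 : Real.exp (-2 * (n:ℝ)) = Real.exp (-(n:ℝ)) * Real.exp (-(n:ℝ)) := by
    rw [← Real.exp_add]; congr 1; ring
  constructor
  · have hQ := Q_bound V hVc L (1 + 8 * Real.exp (-2 * n)) hL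
      (by have := Real.exp_pos (-2 * (n:ℝ)); linarith) n k (by
        intro hk
        have hk1 : ((k - 1 : ℕ) : ℝ) = k - 1 := by
          rw [Nat.cast_sub hk]; norm_num
        apply H n (k-1)
        · rw [hk1]; linarith
        · rw [hk1]
          have : 0 ≤ ε * n := by positivity
          rw [hκ] at hkn
          nlinarith)
    refine hQ.trans ?_
    have hnE : (n:ℝ) * Real.exp (-(n:ℝ)) ≤ 1 := by
      rw [Real.exp_neg, ← div_eq_mul_inv, div_le_one (Real.exp_pos _)]
      have := Real.add_one_le_exp (n:ℝ)
      linarith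
    set t : ℝ := 8 * κ * Real.exp (-(n:ℝ)) with ht
    have ht0 : 0 ≤ t := by positivity
    have h1 : (1 + 8 * Real.exp (-2 * (n:ℝ)))^k ≤ Real.exp t := by
      calc (1 + 8 * Real.exp (-2 * (n:ℝ)))^k ≤ Real.exp (8 * Real.exp (-2 * (n:ℝ))) ^ k := by
            gcongr
            have := Real.add_one_le_exp (8 * Real.exp (-2 * (n:ℝ)))
            linarith
        _ = Real.exp (k * (8 * Real.exp (-2 * (n:ℝ)))) := by rw [← Real.exp_nat_mul]
        _ ≤ Real.exp t := by
            apply Real.exp_le_exp.mpr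
            rw [hE2, ht]
            calc (k:ℝ) * (8 * (Real.exp (-(n:ℝ)) * Real.exp (-(n:ℝ))))
                ≤ (κ * n) * (8 * (Real.exp (-(n:ℝ)) * Real.exp (-(n:ℝ)))) := by gcongr
              _ = 8 * κ * Real.exp (-(n:ℝ)) * (n * Real.exp (-(n:ℝ))) := by ring
              _ ≤ 8 * κ * Real.exp (-(n:ℝ)) * 1 := by gcongr
              _ = _ := by ring
    have h2 : Real.exp t - 1 ≤ t * Real.exp t := by
      have a := Real.add_one_le_exp (-t)
      have b : Real.exp (-t) * Real.exp t = 1 := by rw [← Real.exp_add]; simp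
      nlinarith [Real.exp_pos t]
    have h3 : Real.exp t ≤ Real.exp (8*κ) := by
      apply Real.exp_le_exp.mpr
      rw [ht]
      have : 0 < 8 * κ := by positivity
      nlinarith
    have h4 : t * Real.exp t ≤ 8*κ*Real.exp (8*κ) * Real.exp (-(n:ℝ)) := by
      calc t * Real.exp t ≤ t * Real.exp (8*κ) := by gcongr
        _ = _ := by rw [ht]; ring
    have h5 : 0 ≤ (Real.exp (8/ε) + 8) * Real.exp (-(n:ℝ)) := by positivity
    linarith
  · intro p pL hp hpL
    have ha := hp.2.1 k
    have hb := hpL.2.1 k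
    have hca : (p k).coeff k = (p k).leadingCoeff := by rw [Polynomial.leadingCoeff, hp.1]
    have hcb : (pL k).coeff k = (pL k).leadingCoeff := by rw [Polynomial.leadingCoeff, hpL.1]
    obtain ⟨-, e1⟩ := op_extremal V hVc n _ pL hpL k (p k) (hp.1 k).le
    obtain ⟨i2, e2⟩ := op_extremal V hVc n _ p hp k (pL k) (hpL.1 k).le
    obtain ⟨i3, -⟩ := op_extremal V hVc n _ p hp k (p k) (hp.1 k).le
    obtain ⟨i4, -⟩ := op_extremal V hVc n _ pL hpL k (pL k) (hpL.1 k).le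
    rw [hca] at e1
    rw [hcb] at e2
    have o1 := hp.2.2 k k
    have o2 := hpL.2.2 k k
    rw [if_pos rfl] at o1 o2
    simp only [← sq] at o1 o2
    set a := (p k).leadingCoeff
    set b := (pL k).leadingCoeff
    have hr0 : 0 < a / b := div_pos ha hb
    have hr1 : (a / b)^2 ≤ 1 := by
      refine e1.trans (le_trans ?_ o1.le)
      exact setIntegral_mono_set i3 (Eventually.of_forall fun x => by positivity)
        (subset_univ _).eventuallyLE
    have hr2 : a / b ≤ 1 := by nlinarith
    rw [abs_sub_comm, abs_of_nonneg (by linarith)]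
    have hK : 0 ≤ 8*κ*Real.exp (8*κ) * Real.exp (-(n:ℝ)) := by positivity
    have hK2 : 0 ≤ Real.exp (8/ε) * Real.exp (-(n:ℝ)) := by positivity
    by_cases hn : 8/ε ≤ n
    · have hεn : 8 ≤ ε * n := by
        rw [div_le_iff₀ hε] at hn; linarith
      have h1 := H n k hkn (by rw [hκ] at hkn; nlinarith) (pL k) (hpL.1 k).le
      rw [Measure.restrict_univ] at e2
      have i2' := integrableOn_univ.mp i2
      rw [← ofReal_integral_eq_lintegral_ofReal i2' (Eventually.of_forall fun x => by positivity),
        ← ofReal_integral_eq_lintegral_ofReal i4 (Eventually.of_forall fun x => by positivity),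
        o2, ENNReal.ofReal_one, mul_one, ENNReal.ofReal_le_ofReal_iff (by positivity)] at h1
      have h2 : (b / a)^2 ≤ 1 + 8 * Real.exp (-2 * n) := e2.trans h1
      have h3 : (b / a) * (a / b) = 1 := by field_simp
      have h4 : 1 ≤ (1 + 8 * Real.exp (-2 * n)) * (a/b)^2 := by
        calc (1:ℝ) = (b/a)^2 * (a/b)^2 := by rw [← mul_pow, h3, one_pow]
          _ ≤ _ := by gcongr
      have h5 : Real.exp (-2 * (n:ℝ)) ≤ Real.exp (-(n:ℝ)) := by rw [hE2]; nlinarith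
      have h6 : 8 * Real.exp (-2 * (n:ℝ)) * (a/b)^2 ≤ 8 * Real.exp (-2 * (n:ℝ)) * 1 := by
        gcongr
      have h7 : (a/b)^2 ≤ a/b := by
        rw [sq]; exact mul_le_of_le_one_right hr0.le hr2
      rw [add_mul, add_mul]
      linarith
    · have h1 : 1 ≤ Real.exp (8/ε) * Real.exp (-(n:ℝ)) := by
        rw [← Real.exp_add]
        apply Real.one_le_exp
        linarith
      rw [add_mul, add_mul]
      linarith
end
end

section
/- (Spectral representation of the imaginary part of the Green's kernel.) Let a, c > 0 and ζ ∈ ℂ with Im ζ > 0. Then for all x, y ∈ ℝ, Im R_ζ(x,y) = (2/(κa)) ∫_ℝ Ai(κx + γξ)·Ai(κy + γξ)·(Im ζ/((ξ − Re ζ)² + (Im ζ)²)) dξ. -/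
open MeasureTheory Filter Set

noncomputable section

/-- `Bi` is the second Airy function: an entire solution of `Bi'' = z·Bi` which is real on
the real axis, where it is given by the standard integral representation. -/
def IsAiryBi (Bi : ℂ → ℂ) : Prop :=
  Differentiable ℂ Bi ∧ (∀ z, deriv (deriv Bi) z = z * Bi z) ∧
    ∀ x : ℝ, (Bi x).im = 0 ∧
      Tendsto (fun R : ℝ => (1 / Real.pi) *
          ∫ t in (0:ℝ)..R, (Real.exp (-t ^ 3 / 3 + x * t) + Real.sin (t ^ 3 / 3 + x * t)))
        atTop (nhds ((Bi x).re))

/-- The Green's kernel `R_ζ(x,y)` of the operator `A = (a/2) d²/dx² - 2cx`,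
built from the Airy functions `Ai` and `Ci = i·Ai - Bi`. -/
def greenKernel (Ai Bi : ℂ → ℂ) (a c : ℝ) (ζ : ℂ) (x y : ℝ) : ℂ :=
  let κ : ℝ := (4 * c / a) ^ ((1:ℝ)/3)
  let γ : ℝ := (2 * c ^ 2 * a) ^ (-(1:ℝ)/3)
  let Ci : ℂ → ℂ := fun w => Complex.I * Ai w - Bi w
  if x ≤ y then (2 * Real.pi / (κ * a)) * Ci (κ * x + γ * ζ) * Ai (κ * y + γ * ζ)
  else (2 * Real.pi / (κ * a)) * Ci (κ * y + γ * ζ) * Ai (κ * x + γ * ζ)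

/-- The moments of `exp (-s^3/3 + z s)` on the half line. -/
def mE (n : ℕ) (z : ℂ) : ℂ :=
  ∫ s in Ioi (0:ℝ), (s:ℂ) ^ n * Complex.exp (-(s:ℂ) ^ 3 / 3 + z * s)

/-- The dominating function. -/
def dE (n : ℕ) (s : ℝ) : ℝ := s ^ n * Real.exp (-(2/9) * s ^ 3)

def DE (n : ℕ) : ℝ := ∫ s in Ioi (0:ℝ), dE n s

lemma dE_nonneg (n : ℕ) {s : ℝ} (hs : 0 < s) : 0 ≤ dE n s := by unfold dE; positivity

lemma dE_integrable (n : ℕ) : IntegrableOn (dE n) (Ioi 0) := by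
  have h := @integrableOn_rpow_mul_exp_neg_mul_rpow 3 n (2/9) (by have := n.cast_nonneg (α := ℝ); linarith)
    (by norm_num) (by norm_num)
  refine h.congr_fun (fun s hs => ?_) measurableSet_Ioi
  have h3 : s ^ (3:ℝ) = s ^ 3 := by exact_mod_cast Real.rpow_natCast s 3
  simp only [dE, Real.rpow_natCast, h3]

lemma DE_nonneg (n : ℕ) : 0 ≤ DE n :=
  setIntegral_nonneg measurableSet_Ioi fun _ hs => dE_nonneg n hs

lemma young_aux {r s : ℝ} (hr : 0 ≤ r) (hs : 0 < s) : r * s ≤ s ^ 3 / 9 + 3 * r ^ (3/2:ℝ) := by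
  have h1 : r ^ (3/2:ℝ) = r * Real.sqrt r := by
    rw [Real.sqrt_eq_rpow, ← Real.rpow_one_add' hr (by norm_num)]; norm_num
  rw [h1]
  have h2 := Real.sqrt_nonneg r
  have h3 := Real.mul_self_sqrt hr
  set q := Real.sqrt r
  rw [← h3]
  by_cases h : s ≤ 3 * q
  · have : q * q * s ≤ q * q * (3 * q) := by gcongr
    nlinarith [pow_pos hs 3]
  · push Not at h
    have : (3 * q) * (3 * q) * s ≤ s * s * s := by gcongr
    nlinarith [mul_nonneg (mul_nonneg h2 h2) h2]

lemma norm_integrand (n : ℕ) (z : ℂ) {s : ℝ} (hs : 0 < s) :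
    ‖(s:ℂ) ^ n * Complex.exp (-(s:ℂ) ^ 3 / 3 + z * s)‖ = s ^ n * Real.exp (-s ^ 3 / 3 + z.re * s) := by
  rw [norm_mul, norm_pow, Complex.norm_exp, Complex.norm_real, Real.norm_of_nonneg hs.le]
  congr 2
  have : (-(s:ℂ) ^ 3 / 3 + z * s) = ((-s ^ 3 / 3 : ℝ) : ℂ) + z * s := by push_cast; ring
  rw [this, Complex.add_re, Complex.ofReal_re, Complex.re_mul_ofReal]

lemma norm_integrand_le (n : ℕ) (z : ℂ) {R : ℝ} (hz : ‖z‖ ≤ R) {s : ℝ} (hs : 0 < s) :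
    ‖(s:ℂ) ^ n * Complex.exp (-(s:ℂ) ^ 3 / 3 + z * s)‖ ≤ Real.exp (3 * R ^ (3/2:ℝ)) * dE n s := by
  rw [norm_integrand n z hs, dE]
  have hR : 0 ≤ R := (norm_nonneg z).trans hz
  have h1 := young_aux hR hs
  have h2 : z.re * s ≤ R * s := by
    gcongr; exact (Complex.re_le_norm z).trans hz
  calc s ^ n * Real.exp (-s ^ 3 / 3 + z.re * s)
      ≤ s ^ n * Real.exp (3 * R ^ (3/2:ℝ) + -(2/9) * s ^ 3) := by
        refine mul_le_mul_of_nonneg_left (Real.exp_le_exp.2 ?_) (by positivity)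
        linarith
    _ = _ := by rw [Real.exp_add]; ring

lemma norm_integrand_le_of_re_nonpos (n : ℕ) (z : ℂ) (hz : z.re ≤ 0) {s : ℝ} (hs : 0 < s) :
    ‖(s:ℂ) ^ n * Complex.exp (-(s:ℂ) ^ 3 / 3 + z * s)‖ ≤ dE n s := by
  rw [norm_integrand n z hs, dE]
  gcongr
  nlinarith [pow_pos hs 3]

lemma integrand_cont (n : ℕ) (z : ℂ) :
    Continuous fun s : ℝ => (s:ℂ) ^ n * Complex.exp (-(s:ℂ) ^ 3 / 3 + z * s) := by fun_prop

lemma integrand_integrable (n : ℕ) (z : ℂ) :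
    IntegrableOn (fun s : ℝ => (s:ℂ) ^ n * Complex.exp (-(s:ℂ) ^ 3 / 3 + z * s)) (Ioi 0) := by
  refine Integrable.mono' ((dE_integrable n).const_mul (Real.exp (3 * ‖z‖ ^ (3/2:ℝ))))
    (integrand_cont n z).aestronglyMeasurable ?_
  filter_upwards [ae_restrict_mem measurableSet_Ioi] with s hs
  exact norm_integrand_le n z le_rfl hs

lemma mE_growth (n : ℕ) (z : ℂ) : ‖mE n z‖ ≤ DE n * Real.exp (3 * ‖z‖ ^ (3/2:ℝ)) := by
  have := norm_integral_le_of_norm_le ((dE_integrable n).const_mul (Real.exp (3 * ‖z‖ ^ (3/2:ℝ))))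
    (f := fun s : ℝ => (s:ℂ) ^ n * Complex.exp (-(s:ℂ) ^ 3 / 3 + z * s)) (by
      filter_upwards [ae_restrict_mem measurableSet_Ioi] with s hs
      exact norm_integrand_le n z le_rfl hs)
  rw [integral_const_mul] at this
  rw [mul_comm]; exact this

lemma mE_le (n : ℕ) (z : ℂ) (hz : z.re ≤ 0) : ‖mE n z‖ ≤ DE n :=
  norm_integral_le_of_norm_le (dE_integrable n) (by
      filter_upwards [ae_restrict_mem measurableSet_Ioi] with s hs
      exact norm_integrand_le_of_re_nonpos n z hz hs)

lemma mE_hasDerivAt (n : ℕ) (z : ℂ) : HasDerivAt (mE n) (mE (n+1) z) z := by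
  refine (hasDerivAt_integral_of_dominated_loc_of_deriv_le (μ := volume.restrict (Ioi (0:ℝ)))
    (bound := fun s => Real.exp (3 * (‖z‖+1) ^ (3/2:ℝ)) * dE (n+1) s)
    (F := fun z s => ((s:ℝ):ℂ) ^ n * Complex.exp (-(s:ℂ) ^ 3 / 3 + z * s))
    (F' := fun z s => ((s:ℝ):ℂ) ^ (n+1) * Complex.exp (-(s:ℂ) ^ 3 / 3 + z * s))
    (Metric.ball_mem_nhds z one_pos) ?_ (integrand_integrable n z)
    (integrand_cont (n+1) z).aestronglyMeasurable ?_ ((dE_integrable (n+1)).const_mul _) ?_).2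
  · exact Eventually.of_forall fun w => (integrand_cont n w).aestronglyMeasurable
  · filter_upwards [ae_restrict_mem measurableSet_Ioi] with s hs w hw
    refine norm_integrand_le (n+1) w ?_ hs
    have : ‖w - z‖ < 1 := by simpa [dist_eq_norm] using hw
    have h2 : ‖w‖ ≤ ‖w - z‖ + ‖z‖ := by simpa using norm_add_le (w - z) z
    linarith
  · refine Eventually.of_forall fun s w _ => ?_
    have h1 : HasDerivAt (fun w : ℂ => -(s:ℂ) ^ 3 / 3 + w * s) ((s:ℂ)) w := by
      simpa using ((hasDerivAt_id w).mul_const (s:ℂ)).const_add (-(s:ℂ) ^ 3 / 3)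
    exact (h1.cexp.const_mul ((s:ℂ)^n)).congr_deriv (by ring)

lemma mE_ode (z : ℂ) : mE 2 z = z * mE 0 z + 1 := by
  have h := integral_Ioi_of_hasDerivAt_of_tendsto' (a := 0) (m := 0)
    (f := fun s : ℝ => Complex.exp (-(s:ℂ) ^ 3 / 3 + z * s))
    (f' := fun s : ℝ => z * ((s:ℂ) ^ 0 * Complex.exp (-(s:ℂ) ^ 3 / 3 + z * s))
      - (s:ℂ) ^ 2 * Complex.exp (-(s:ℂ) ^ 3 / 3 + z * s)) ?_ ?_ ?_
  · rw [integral_sub ((integrand_integrable 0 z).const_mul z) (integrand_integrable 2 z),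
      integral_const_mul] at h
    change z * mE 0 z - mE 2 z = _ at h
    simp at h
    linear_combination -h
  · intro s _
    have h1 : HasDerivAt (fun w : ℂ => -w ^ 3 / 3 + z * w) (-(s:ℂ)^2 + z) (s:ℂ) := by
      have := (((hasDerivAt_pow 3 (s:ℂ)).neg).div_const 3).add ((hasDerivAt_id (s:ℂ)).const_mul z)
      exact this.congr_deriv (by push_cast; ring)
    exact h1.comp_ofReal.cexp.congr_deriv (by ring)
  · exact ((integrand_integrable 0 z).const_mul z).sub (integrand_integrable 2 z)
  · rw [tendsto_zero_iff_norm_tendsto_zero]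
    have h2 : Tendsto (fun s : ℝ => Real.exp (3 * ‖z‖ ^ (3/2:ℝ)) * Real.exp (-s)) atTop (nhds 0) := by
      simpa using (Real.tendsto_exp_neg_atTop_nhds_zero).const_mul (Real.exp (3 * ‖z‖ ^ (3/2:ℝ)))
    refine squeeze_zero' (Eventually.of_forall fun _ => norm_nonneg _) ?_ h2
    filter_upwards [eventually_ge_atTop 3] with s hs
    have h3 := norm_integrand_le 0 z le_rfl (s := s) (by linarith)
    rw [pow_zero, one_mul] at h3
    refine h3.trans ?_
    simp only [dE, pow_zero, one_mul]
    gcongr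
    nlinarith [mul_nonneg (sub_nonneg.2 hs) (sub_nonneg.2 hs)]

lemma mE_ode' (z : ℂ) : mE 3 z = z * mE 1 z + mE 0 z := by
  have h1 := mE_hasDerivAt 2 z
  have h2 : HasDerivAt (fun z => z * mE 0 z + 1) (1 * mE 0 z + z * mE 1 z) z :=
    ((hasDerivAt_id z).mul (mE_hasDerivAt 0 z)).add_const 1
  have h3 : mE 2 = fun z => z * mE 0 z + 1 := funext mE_ode
  rw [h3] at h1
  rw [h1.unique h2]; ring

lemma mE0_decay (z : ℂ) (hz : z.re ≤ 0) : ‖z‖ * ‖mE 0 z‖ ≤ DE 2 + 1 := by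
  have h := mE_le 2 z hz
  rw [← norm_mul, show z * mE 0 z = mE 2 z - 1 by rw [mE_ode]; ring]
  refine (norm_sub_le _ _).trans ?_
  simpa using h

lemma mE1_decay (z : ℂ) (hz : z.re ≤ 0) : ‖z‖ * ‖mE 1 z‖ ≤ DE 3 + DE 0 := by
  have h := mE_le 3 z hz
  have h' := mE_le 0 z hz
  rw [← norm_mul, show z * mE 1 z = mE 3 z - mE 0 z by rw [mE_ode']; ring]
  exact (norm_sub_le _ _).trans (add_le_add h h')

lemma mE_conj (n : ℕ) (z : ℂ) : mE n (starRingEnd ℂ z) = starRingEnd ℂ (mE n z) := by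
  rw [mE, mE, ← integral_conj]
  congr 1
  ext s
  have h3 : starRingEnd ℂ (3:ℂ) = 3 := Complex.conj_ofNat 3
  simp [← Complex.exp_conj, h3]

def om : ℂ := ⟨-1/2, Real.sqrt 3 / 2⟩
def omb : ℂ := ⟨-1/2, -(Real.sqrt 3 / 2)⟩
def e6 : ℂ := ⟨Real.sqrt 3 / 2, 1/2⟩

lemma sq3 : Real.sqrt 3 * Real.sqrt 3 = 3 := Real.mul_self_sqrt (by norm_num)
lemma sq3_pos : 0 < Real.sqrt 3 := Real.sqrt_pos.2 (by norm_num)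

lemma I_e6 : Complex.I * e6 = om := by
  apply Complex.ext <;> simp [e6, om]; norm_num

lemma e6_cube : e6 ^ 3 = Complex.I := by
  have h := sq3
  apply Complex.ext <;> simp [e6, pow_succ]
  · linear_combination (Real.sqrt 3 / 8) * h
  · linear_combination (3 / 8) * h

lemma om_cube : om ^ 3 = 1 := by
  rw [← I_e6, mul_pow, e6_cube]
  simp [pow_succ]

lemma omb_eq : omb = starRingEnd ℂ om := by
  apply Complex.ext <;> simp [om, omb]

lemma omb_cube : omb ^ 3 = 1 := by
  rw [omb_eq, ← map_pow, om_cube, map_one]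

lemma rot_bound (x : ℝ) (hx : 0 ≤ x) (Φ : ℂ → ℂ)
    (hΦ : ∀ z, HasDerivAt Φ (Complex.exp (Complex.I * (z ^ 3 / 3 + x * z))) z) (R : ℝ) (hR : 0 < R) :
    ‖Φ (e6 * ((2 / Real.sqrt 3 * R : ℝ) : ℂ)) - Φ R‖ ≤ 9 / (8 * R ^ 2) := by
  have hs := sq3
  have hsp := sq3_pos
  have key := image_norm_le_of_norm_deriv_right_le_deriv_boundary
    (f := fun y : ℝ => Φ (R + y * Complex.I) - Φ R)
    (f' := fun y : ℝ => Complex.exp (Complex.I * ((R + y * Complex.I) ^ 3 / 3 + x * (R + y * Complex.I))) * Complex.I)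
    (a := 0) (b := R / Real.sqrt 3)
    (B := fun y => 9 / (8 * R ^ 2) * (1 - Real.exp (-(8/9 * R ^ 2) * y)))
    (B' := fun y => Real.exp (-(8/9 * R ^ 2) * y)) ?_ ?_ ?_ ?_ ?_
    (x := R / Real.sqrt 3) ⟨by positivity, le_rfl⟩
  · have e : e6 * ((2 / Real.sqrt 3 * R : ℝ) : ℂ) = R + ((R / Real.sqrt 3 : ℝ) : ℂ) * Complex.I := by
      apply Complex.ext
      · simp [e6]; field_simp
      · simp [e6]; field_simp
    rw [e]
    refine key.trans ?_
    have := Real.exp_pos (-(8/9 * R ^ 2) * (R / Real.sqrt 3))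
    have h2 : 0 < 9 / (8 * R ^ 2) := by positivity
    nlinarith
  · have hc : Continuous Φ := by
      rw [continuous_iff_continuousAt]; exact fun z => (hΦ z).continuousAt
    fun_prop
  · intro y _
    have h1 : HasDerivAt (fun w : ℂ => R + w * Complex.I) Complex.I (y:ℂ) := by
      simpa using ((hasDerivAt_id (y:ℂ)).mul_const Complex.I).const_add (R:ℂ)
    have h2 := ((hΦ (R + y * Complex.I)).comp (y:ℂ) h1).comp_ofReal
    exact (h2.sub_const (Φ R)).hasDerivWithinAt
  · simp
  · intro y
    have h1 : HasDerivAt (fun y : ℝ => -(8/9 * R ^ 2) * y) (-(8/9 * R ^ 2)) y := by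
      simpa using (hasDerivAt_id y).const_mul (-(8/9 * R ^ 2))
    refine ((h1.exp.const_sub 1).const_mul (9 / (8 * R ^ 2))).congr_deriv ?_
    field_simp
  · intro y hy
    rw [norm_mul, Complex.norm_I, mul_one, Complex.norm_exp]
    refine Real.exp_le_exp.2 ?_
    have e : (Complex.I * ((R + y * Complex.I) ^ 3 / 3 + x * (R + y * Complex.I))).re
        = - R ^ 2 * y + y ^ 3 / 3 - x * y := by
      have : (Complex.I * ((R + y * Complex.I) ^ 3 / 3 + x * (R + y * Complex.I)))
        = ((- R ^ 2 * y + y ^ 3 / 3 - x * y : ℝ) : ℂ) + ((R ^ 3 / 3 - R * y ^ 2 + x * R : ℝ) : ℂ) * Complex.I := by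
        push_cast
        linear_combination ((R:ℂ) ^2 * y + R * y ^ 2 * Complex.I + (y:ℂ)^3 / 3 * (Complex.I ^ 2 - 1) + x * y) * Complex.I_sq
      rw [this, Complex.add_re, Complex.ofReal_re, Complex.re_ofReal_mul, Complex.I_re, mul_zero, add_zero]
    rw [e]
    have hy0 : 0 ≤ y := hy.1
    have hy1 : y * Real.sqrt 3 ≤ R := by
      have := hy.2.le
      rwa [le_div_iff₀ hsp] at this
    have hy2 : 3 * y ^ 2 ≤ R ^ 2 := by
      have : (y * Real.sqrt 3) * (y * Real.sqrt 3) ≤ R * R := by gcongr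
      nlinarith
    have : y * (3 * y ^ 2) ≤ y * R ^ 2 := by gcongr
    nlinarith [mul_nonneg hx hy0]

lemma rot_limit (x : ℝ) (hx : 0 ≤ x) :
    Tendsto (fun R : ℝ => ∫ t in (0:ℝ)..R, Complex.exp (Complex.I * ((t:ℂ) ^ 3 / 3 + x * t))) atTop
      (nhds (e6 * mE 0 (om * x))) := by
  have hsp := sq3_pos
  have hd : Differentiable ℂ fun z : ℂ => Complex.exp (Complex.I * (z ^ 3 / 3 + x * z)) := by fun_prop
  obtain ⟨Φ, hΦ'⟩ := hd.isExactOn_univ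
  have hΦ : ∀ z, HasDerivAt Φ (Complex.exp (Complex.I * (z ^ 3 / 3 + x * z))) z := fun z => hΦ' z (mem_univ z)
  have h1 : ∀ R : ℝ, ∫ t in (0:ℝ)..R, Complex.exp (Complex.I * ((t:ℂ) ^ 3 / 3 + x * t)) = Φ R - Φ 0 := by
    intro R
    have := intervalIntegral.integral_eq_sub_of_hasDerivAt (a := 0) (b := R)
      (f := fun t : ℝ => Φ t) (f' := fun t : ℝ => Complex.exp (Complex.I * ((t:ℂ) ^ 3 / 3 + x * t)))
      (fun t _ => (hΦ t).comp_ofReal) (by apply Continuous.intervalIntegrable; fun_prop)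
    simpa using this
  have h2 : ∀ S : ℝ, ∫ s in (0:ℝ)..S, e6 * ((s:ℂ) ^ 0 * Complex.exp (-(s:ℂ) ^ 3 / 3 + (om * x) * s)) =
      Φ (e6 * (S:ℂ)) - Φ 0 := by
    intro S
    have := intervalIntegral.integral_eq_sub_of_hasDerivAt (a := 0) (b := S)
      (f := fun t : ℝ => Φ (e6 * (t:ℂ)))
      (f' := fun s : ℝ => e6 * ((s:ℂ) ^ 0 * Complex.exp (-(s:ℂ) ^ 3 / 3 + (om * x) * s))) ?_
      (by apply Continuous.intervalIntegrable; fun_prop)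
    · simpa using this
    · intro s _
      have h1 : HasDerivAt (fun w : ℂ => e6 * w) e6 (s:ℂ) := by
        simpa using ((hasDerivAt_id (s:ℂ)).const_mul e6)
      refine (((hΦ (e6 * s)).comp (s:ℂ) h1).comp_ofReal).congr_deriv ?_
      rw [pow_zero, one_mul, mul_comm]
      congr 2
      rw [mul_pow, e6_cube, ← I_e6]
      linear_combination (s:ℂ)^3/3 * Complex.I_sq
  have hS : Tendsto (fun R : ℝ => 2 / Real.sqrt 3 * R) atTop atTop :=
    tendsto_id.const_mul_atTop (by positivity)
  have h3 : Tendsto (fun R : ℝ => Φ (e6 * ((2 / Real.sqrt 3 * R : ℝ) : ℂ)) - Φ 0) atTop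
      (nhds (e6 * mE 0 (om * x))) := by
    have := intervalIntegral_tendsto_integral_Ioi 0 ((integrand_integrable 0 (om * x)).const_mul e6) hS
    simp only [h2] at this
    rw [integral_const_mul] at this
    exact this
  have h4 : Tendsto (fun R : ℝ => Φ (e6 * ((2 / Real.sqrt 3 * R : ℝ) : ℂ)) - Φ R) atTop (nhds 0) := by
    rw [tendsto_zero_iff_norm_tendsto_zero]
    refine squeeze_zero' (Eventually.of_forall fun _ => norm_nonneg _)
      (g := fun R : ℝ => 9 / (8 * R ^ 2)) ?_ ?_
    · filter_upwards [eventually_gt_atTop 0] with R hR using rot_bound x hx Φ hΦ R hR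
    · refine tendsto_const_nhds.div_atTop ?_
      exact (tendsto_pow_atTop two_ne_zero).const_mul_atTop (by norm_num)
  have h5 := h3.sub h4
  simp only [h1]
  rw [sub_zero] at h5
  refine h5.congr fun R => ?_
  ring

lemma exp_split (x t : ℝ) : Complex.exp (Complex.I * ((t:ℂ) ^ 3 / 3 + x * t)) =
    ⟨Real.cos (t ^ 3 / 3 + x * t), Real.sin (t ^ 3 / 3 + x * t)⟩ := by
  have : Complex.I * ((t:ℂ) ^ 3 / 3 + x * t) = ((t ^ 3 / 3 + x * t : ℝ) : ℂ) * Complex.I := by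
    push_cast; ring
  rw [this]
  apply Complex.ext
  · rw [Complex.exp_ofReal_mul_I_re]
  · rw [Complex.exp_ofReal_mul_I_im]

lemma cos_limit (x : ℝ) (hx : 0 ≤ x) :
    Tendsto (fun R : ℝ => ∫ t in (0:ℝ)..R, Real.cos (t ^ 3 / 3 + x * t)) atTop
      (nhds (e6 * mE 0 (om * x)).re) := by
  have h := (Complex.continuous_re.tendsto _).comp (rot_limit x hx)
  refine h.congr fun R => ?_
  have hi : IntervalIntegrable (fun t : ℝ => Complex.exp (Complex.I * ((t:ℂ) ^ 3 / 3 + x * t))) volume 0 R := by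
    apply Continuous.intervalIntegrable; fun_prop
  have := Complex.reCLM.intervalIntegral_comp_comm hi
  simp only [Complex.reCLM_apply] at this
  rw [Function.comp_apply, ← this]
  simp only [exp_split]

lemma sin_limit (x : ℝ) (hx : 0 ≤ x) :
    Tendsto (fun R : ℝ => ∫ t in (0:ℝ)..R, Real.sin (t ^ 3 / 3 + x * t)) atTop
      (nhds (e6 * mE 0 (om * x)).im) := by
  have h := (Complex.continuous_im.tendsto _).comp (rot_limit x hx)
  refine h.congr fun R => ?_
  have hi : IntervalIntegrable (fun t : ℝ => Complex.exp (Complex.I * ((t:ℂ) ^ 3 / 3 + x * t))) volume 0 R := by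
    apply Continuous.intervalIntegrable; fun_prop
  have := Complex.imCLM.intervalIntegral_comp_comm hi
  simp only [Complex.imCLM_apply] at this
  rw [Function.comp_apply, ← this]
  simp only [exp_split]

lemma exp_limit (x : ℝ) :
    Tendsto (fun R : ℝ => ∫ t in (0:ℝ)..R, Real.exp (-t ^ 3 / 3 + x * t)) atTop
      (nhds (mE 0 x).re) := by
  have h := (Complex.continuous_re.tendsto _).comp
    (intervalIntegral_tendsto_integral_Ioi 0 (integrand_integrable 0 x) tendsto_id)
  refine h.congr fun R => ?_
  have hi : IntervalIntegrable (fun s : ℝ => (s:ℂ) ^ 0 * Complex.exp (-(s:ℂ) ^ 3 / 3 + x * s)) volume 0 R :=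
    (integrand_cont 0 x).intervalIntegrable _ _
  have := Complex.reCLM.intervalIntegral_comp_comm hi
  simp only [Complex.reCLM_apply] at this
  rw [Function.comp_apply, id, ← this]
  refine intervalIntegral.integral_congr fun t _ => ?_
  simp only [pow_zero, one_mul]
  have e : (-(t:ℂ) ^ 3 / 3 + x * t) = ((-t ^ 3 / 3 + x * t : ℝ) : ℂ) := by push_cast; ring
  rw [e, ← Complex.ofReal_exp, Complex.ofReal_re]

def A0 (z : ℂ) : ℂ := 1 / (2 * Real.pi * Complex.I) * (om * mE 0 (om * z) - omb * mE 0 (omb * z))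
def A1 (z : ℂ) : ℂ := 1 / (2 * Real.pi * Complex.I) * (om ^ 2 * mE 1 (om * z) - omb ^ 2 * mE 1 (omb * z))
def C0 (z : ℂ) : ℂ := 1 / Real.pi * (om * mE 0 (om * z) - mE 0 z)
def C1 (z : ℂ) : ℂ := 1 / Real.pi * (om ^ 2 * mE 1 (om * z) - mE 1 z)

lemma mEk0 (k z : ℂ) : HasDerivAt (fun z => k * mE 0 (k * z)) (k ^ 2 * mE 1 (k * z)) z := by
  have h1 : HasDerivAt (fun w : ℂ => k * w) k z := by
    simpa using ((hasDerivAt_id z).const_mul k)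
  exact (((mE_hasDerivAt 0 (k * z)).comp z h1).const_mul k).congr_deriv (by ring)

lemma mEk1 (k z : ℂ) (hk : k ^ 3 = 1) :
    HasDerivAt (fun z => k ^ 2 * mE 1 (k * z)) (z * (k * mE 0 (k * z)) + 1) z := by
  have h1 : HasDerivAt (fun w : ℂ => k * w) k z := by
    simpa using ((hasDerivAt_id z).const_mul k)
  refine (((mE_hasDerivAt 1 (k * z)).comp z h1).const_mul (k ^ 2)).congr_deriv ?_
  rw [mE_ode]
  linear_combination (k * z * mE 0 (k * z) + 1) * hk

lemma A0_deriv (z : ℂ) : HasDerivAt A0 (A1 z) z :=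
  ((mEk0 om z).sub (mEk0 omb z)).const_mul _

lemma A1_deriv (z : ℂ) : HasDerivAt A1 (z * A0 z) z :=
  (((mEk1 om z om_cube).sub (mEk1 omb z omb_cube)).const_mul _).congr_deriv (by rw [A0]; ring)

lemma C0_deriv (z : ℂ) : HasDerivAt C0 (C1 z) z :=
  ((mEk0 om z).sub (mE_hasDerivAt 0 z)).const_mul _

lemma C1_deriv (z : ℂ) : HasDerivAt C1 (z * C0 z) z :=
  (((mEk1 om z om_cube).sub (mE_hasDerivAt 1 z)).const_mul _).congr_deriv (by rw [C0, mE_ode]; ring)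

lemma eq_of_eq_pos (f g : ℂ → ℂ) (hf : Differentiable ℂ f) (hg : Differentiable ℂ g)
    (h : ∀ x : ℝ, 0 ≤ x → f x = g x) : f = g := by
  refine AnalyticOnNhd.eq_of_frequently_eq (z₀ := 0) (fun z _ => hf.analyticAt z)
    (fun z _ => hg.analyticAt z) ?_
  have ht : Tendsto (fun x : ℝ => (x:ℂ)) (nhdsWithin 0 (Ioi 0)) (nhdsWithin 0 {0}ᶜ) := by
    refine tendsto_nhdsWithin_iff.2 ⟨?_, ?_⟩
    · have := (Complex.continuous_ofReal.tendsto 0).mono_left (nhdsWithin_le_nhds (s := Ioi (0:ℝ)))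
      simpa using this
    · filter_upwards [self_mem_nhdsWithin] with x hx
      have : x ≠ 0 := ne_of_gt hx
      simpa using this
  refine ht.frequently (Eventually.frequently ?_)
  filter_upwards [self_mem_nhdsWithin] with x hx
  exact h x (le_of_lt hx)

lemma airy_re (Ai : ℂ → ℂ) (hAi : IsAiryAi Ai) (x : ℝ) (hx : 0 ≤ x) :
    Ai x = ((1 / Real.pi * (e6 * mE 0 (om * x)).re : ℝ) : ℂ) := by
  obtain ⟨_, _, h⟩ := hAi
  have h1 := tendsto_nhds_unique (h x).2 ((cos_limit x hx).const_mul (1 / Real.pi))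
  apply Complex.ext
  · rw [h1, Complex.ofReal_re]
  · rw [(h x).1, Complex.ofReal_im]

lemma biry_re (Bi : ℂ → ℂ) (hBi : IsAiryBi Bi) (x : ℝ) (hx : 0 ≤ x) :
    Bi x = ((1 / Real.pi * ((mE 0 x).re + (e6 * mE 0 (om * x)).im) : ℝ) : ℂ) := by
  obtain ⟨_, _, h⟩ := hBi
  have h1 := ((exp_limit x).add (sin_limit x hx)).const_mul (1 / Real.pi)
  have h2 := tendsto_nhds_unique (h x).2 (h1.congr fun R => ?_)
  · apply Complex.ext
    · rw [h2, Complex.ofReal_re]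
    · rw [(h x).1, Complex.ofReal_im]
  · congr 1
    refine (intervalIntegral.integral_add ?_ ?_).symm <;>
    · apply Continuous.intervalIntegrable; fun_prop

lemma Ai_eq (Ai : ℂ → ℂ) (hAi : IsAiryAi Ai) : Ai = A0 := by
  refine eq_of_eq_pos _ _ hAi.1 (fun z => (A0_deriv z).differentiableAt) fun x hx => ?_
  rw [airy_re Ai hAi x hx, A0]
  have h1 : omb * mE 0 (omb * x) = starRingEnd ℂ (om * mE 0 (om * x)) := by
    rw [map_mul, ← mE_conj, map_mul, Complex.conj_ofReal, omb_eq]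
  rw [h1, Complex.sub_conj]
  have h2 : (om * mE 0 (om * x)).im = (e6 * mE 0 (om * x)).re := by
    rw [← I_e6, mul_assoc, Complex.I_mul_im]
  rw [h2]
  have hpi : (Real.pi : ℂ) ≠ 0 := by exact_mod_cast Real.pi_ne_zero
  push_cast
  field_simp [Complex.I_ne_zero]

lemma Ci_eq (Ai Bi : ℂ → ℂ) (hAi : IsAiryAi Ai) (hBi : IsAiryBi Bi) :
    (fun w => Complex.I * Ai w - Bi w) = C0 := by
  refine eq_of_eq_pos _ _ ((hAi.1.const_mul _).sub hBi.1) (fun z => (C0_deriv z).differentiableAt) fun x hx => ?_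
  rw [airy_re Ai hAi x hx, biry_re Bi hBi x hx, C0]
  have h1 : ((mE 0 (x:ℂ)).re : ℂ) = mE 0 x := by
    rw [← Complex.conj_eq_iff_re, ← mE_conj, Complex.conj_ofReal]
  have h2 : om * mE 0 (om * x) = Complex.I * (e6 * mE 0 (om * x)) := by
    rw [← mul_assoc, I_e6]
  rw [h2]
  set L := e6 * mE 0 (om * x)
  have h3 : Complex.I * L = Complex.I * L.re - L.im := by
    apply Complex.ext <;> simp
  rw [h3]
  push_cast
  rw [h1]
  ring

def nsq (z : ℂ) : ℝ := z.re ^ 2 + z.im ^ 2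
def rD (z w : ℂ) : ℝ := z.re * w.re + z.im * w.im
def iD (z w : ℂ) : ℝ := z.re * w.im - z.im * w.re

lemma nsq_nonneg (z : ℂ) : 0 ≤ nsq z := by unfold nsq; positivity
lemma nsq_eq (z : ℂ) : nsq z = ‖z‖ ^ 2 := by
  rw [← Complex.normSq_eq_norm_sq, Complex.normSq_apply, nsq]; ring
lemma two_rD_le (z w : ℂ) : |2 * rD z w| ≤ nsq z + nsq w := by
  rw [abs_le]; unfold rD nsq
  constructor
  · nlinarith [sq_nonneg (z.re + w.re), sq_nonneg (z.im + w.im)]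
  · nlinarith [sq_nonneg (z.re - w.re), sq_nonneg (z.im - w.im)]

lemma hasDerivAt_re {f : ℝ → ℂ} {f' : ℂ} {t : ℝ} (h : HasDerivAt f f' t) :
    HasDerivAt (fun t => (f t).re) f'.re t :=
  (Complex.reCLM.hasFDerivAt.comp_hasDerivAt t h)

lemma hasDerivAt_im {f : ℝ → ℂ} {f' : ℂ} {t : ℝ} (h : HasDerivAt f f' t) :
    HasDerivAt (fun t => (f t).im) f'.im t :=
  (Complex.imCLM.hasFDerivAt.comp_hasDerivAt t h)

lemma nsq_deriv {f : ℝ → ℂ} {f' : ℂ} {t : ℝ} (h : HasDerivAt f f' t) :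
    HasDerivAt (fun t => nsq (f t)) (2 * rD (f t) f') t :=
  (((hasDerivAt_re h).pow 2).add ((hasDerivAt_im h).pow 2)).congr_deriv (by
    simp [rD]; ring)

lemma rD_deriv {f g : ℝ → ℂ} {c : ℂ} {t : ℝ} (hf : HasDerivAt f (g t) t)
    (hg : HasDerivAt g (c * f t) t) :
    HasDerivAt (fun t => rD (f t) (g t)) (nsq (g t) + c.re * nsq (f t)) t :=
  (((hasDerivAt_re hf).mul (hasDerivAt_re hg)).add
    ((hasDerivAt_im hf).mul (hasDerivAt_im hg))).congr_deriv (by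
    simp [nsq]; ring)

lemma iD_deriv {f g : ℝ → ℂ} {c : ℂ} {t : ℝ} (hf : HasDerivAt f (g t) t)
    (hg : HasDerivAt g (c * f t) t) :
    HasDerivAt (fun t => iD (f t) (g t)) (c.im * nsq (f t)) t :=
  (((hasDerivAt_re hf).mul (hasDerivAt_im hg)).sub
    ((hasDerivAt_im hf).mul (hasDerivAt_re hg))).congr_deriv (by
    simp [nsq]; ring)

lemma mono_of_deriv {φ φ' : ℝ → ℝ} {t0 : ℝ} (h : ∀ t, t0 ≤ t → HasDerivAt φ (φ' t) t)
    (h' : ∀ t, t0 ≤ t → 0 ≤ φ' t) : MonotoneOn φ (Ici t0) := by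
  refine monotoneOn_of_deriv_nonneg (convex_Ici t0)
    (fun t ht => (h t ht).continuousAt.continuousWithinAt) ?_ ?_
  · intro t ht
    rw [interior_Ici] at ht
    exact (h t (le_of_lt ht)).differentiableAt.differentiableWithinAt
  · intro t ht
    rw [interior_Ici] at ht
    rw [(h t (le_of_lt ht)).deriv]
    exact h' t (le_of_lt ht)

lemma nonpos_of_deriv {φ φ' : ℝ → ℝ} {t0 : ℝ} (h : ∀ t, t0 ≤ t → HasDerivAt φ (φ' t) t)
    (h' : ∀ t, t0 ≤ t → 0 ≤ φ' t) (hl : Tendsto φ atTop (nhds 0)) {t : ℝ} (ht : t0 ≤ t) : φ t ≤ 0 := by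
  refine ge_of_tendsto hl ?_
  filter_upwards [eventually_ge_atTop t] with u hu
  exact mono_of_deriv h h' ht (ht.trans hu) hu

lemma nsq_tendsto {f : ℝ → ℂ} (hf : Tendsto f atTop (nhds 0)) :
    Tendsto (fun t => nsq (f t)) atTop (nhds 0) := by
  have : Continuous nsq := by unfold nsq; fun_prop
  have h := (this.tendsto 0).comp hf
  simpa [nsq, Function.comp_def] using h

lemma rD_tendsto {f g : ℝ → ℂ} (hf : Tendsto f atTop (nhds 0)) (hg : Tendsto g atTop (nhds 0)) :
    Tendsto (fun t => rD (f t) (g t)) atTop (nhds 0) := by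
  have : Continuous fun p : ℂ × ℂ => rD p.1 p.2 := by unfold rD; fun_prop
  have h := (this.tendsto (0, 0)).comp (hf.prodMk_nhds hg)
  simpa [rD, Function.comp_def] using h

lemma iD_tendsto {f g : ℝ → ℂ} (hf : Tendsto f atTop (nhds 0)) (hg : Tendsto g atTop (nhds 0)) :
    Tendsto (fun t => iD (f t) (g t)) atTop (nhds 0) := by
  have : Continuous fun p : ℂ × ℂ => iD p.1 p.2 := by unfold iD; fun_prop
  have h := (this.tendsto (0, 0)).comp (hf.prodMk_nhds hg)
  simpa [iD, Function.comp_def] using h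

lemma tendsto_zero_of_mul_le {p m : ℝ → ℂ} {K : ℝ} (h : ∀ᶠ t in atTop, ‖p t‖ * ‖m t‖ ≤ K)
    (hn : Tendsto (fun t => ‖p t‖) atTop atTop) : Tendsto m atTop (nhds 0) := by
  rw [tendsto_zero_iff_norm_tendsto_zero]
  refine squeeze_zero' (Eventually.of_forall fun _ => norm_nonneg _)
    (g := fun t => K / ‖p t‖) ?_ (tendsto_const_nhds.div_atTop hn)
  filter_upwards [h, hn.eventually_gt_atTop 0] with t ht hp
  rw [le_div_iff₀ hp, mul_comm]; exact ht

lemma mE0_tendsto {p : ℝ → ℂ} (h : ∀ᶠ t in atTop, (p t).re ≤ 0)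
    (hn : Tendsto (fun t => ‖p t‖) atTop atTop) : Tendsto (fun t => mE 0 (p t)) atTop (nhds 0) :=
  tendsto_zero_of_mul_le (h.mono fun t ht => mE0_decay (p t) ht) hn

lemma mE1_tendsto {p : ℝ → ℂ} (h : ∀ᶠ t in atTop, (p t).re ≤ 0)
    (hn : Tendsto (fun t => ‖p t‖) atTop atTop) : Tendsto (fun t => mE 1 (p t)) atTop (nhds 0) :=
  tendsto_zero_of_mul_le (h.mono fun t ht => mE1_decay (p t) ht) hn

lemma norm_om : ‖om‖ = 1 := Complex.norm_eq_one_of_pow_eq_one om_cube three_ne_zero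
lemma norm_omb : ‖omb‖ = 1 := Complex.norm_eq_one_of_pow_eq_one omb_cube three_ne_zero

lemma comb_tendsto {f g : ℝ → ℂ} (a b c : ℂ) (hf : Tendsto f atTop (nhds 0)) (hg : Tendsto g atTop (nhds 0)) :
    Tendsto (fun t => a * (b * f t - c * g t)) atTop (nhds 0) := by
  simpa using ((hf.const_mul b).sub (hg.const_mul c)).const_mul a

lemma horiz_norm (s : ℝ) : Tendsto (fun x : ℝ => ‖(x:ℂ) + s * Complex.I‖) atTop atTop := by
  refine tendsto_atTop_mono (fun x => ?_) tendsto_id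
  have := Complex.re_le_norm ((x:ℂ) + s * Complex.I)
  simpa using this

lemma A_tendsto (s : ℝ) : Tendsto (fun x : ℝ => A0 (x + s * Complex.I)) atTop (nhds 0) ∧
    Tendsto (fun x : ℝ => A1 (x + s * Complex.I)) atTop (nhds 0) := by
  have h1 : ∀ᶠ x : ℝ in atTop, (om * (x + s * Complex.I)).re ≤ 0 := by
    filter_upwards [eventually_ge_atTop (-(Real.sqrt 3 * s))] with x hx
    simp [om]; linarith
  have h2 : ∀ᶠ x : ℝ in atTop, (omb * (x + s * Complex.I)).re ≤ 0 := by
    filter_upwards [eventually_ge_atTop (Real.sqrt 3 * s)] with x hx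
    simp [omb]; linarith
  have h3 : Tendsto (fun x : ℝ => ‖om * ((x:ℂ) + s * Complex.I)‖) atTop atTop := by
    simpa only [norm_mul, norm_om, one_mul] using horiz_norm s
  have h4 : Tendsto (fun x : ℝ => ‖omb * ((x:ℂ) + s * Complex.I)‖) atTop atTop := by
    simpa only [norm_mul, norm_omb, one_mul] using horiz_norm s
  exact ⟨comb_tendsto _ _ _ (mE0_tendsto h1 h3) (mE0_tendsto h2 h4),
    comb_tendsto _ _ _ (mE1_tendsto h1 h3) (mE1_tendsto h2 h4)⟩

lemma C_tendsto : Tendsto (fun x : ℝ => C0 (x * Complex.I)) atTop (nhds 0) ∧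
    Tendsto (fun x : ℝ => Complex.I * C1 (x * Complex.I)) atTop (nhds 0) := by
  have h1 : ∀ᶠ x : ℝ in atTop, (om * (x * Complex.I)).re ≤ 0 := by
    filter_upwards [eventually_ge_atTop 0] with x hx
    have := sq3_pos
    simp [om]; positivity
  have h2 : ∀ᶠ x : ℝ in atTop, (x * Complex.I : ℂ).re ≤ 0 := by
    simp
  have h4 : Tendsto (fun x : ℝ => ‖((x:ℂ) * Complex.I)‖) atTop atTop := by
    simpa using tendsto_abs_atTop_atTop
  have h3 : Tendsto (fun x : ℝ => ‖om * ((x:ℂ) * Complex.I)‖) atTop atTop := by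
    simpa only [norm_mul, norm_om, one_mul] using h4
  have t0 := comb_tendsto (1 / Real.pi) om 1 (mE0_tendsto h1 h3) (mE0_tendsto h2 h4)
  have t1 := comb_tendsto (1 / Real.pi) (om ^ 2) 1 (mE1_tendsto h1 h3) (mE1_tendsto h2 h4)
  simp only [one_mul] at t0 t1
  refine ⟨t0, ?_⟩
  have t2 := t1.const_mul Complex.I
  rw [mul_zero] at t2
  exact t2

lemma A_horiz (s x : ℝ) : HasDerivAt (fun x : ℝ => A0 (x + s * Complex.I)) (A1 (x + s * Complex.I)) x ∧
    HasDerivAt (fun x : ℝ => A1 (x + s * Complex.I)) ((x + s * Complex.I) * A0 (x + s * Complex.I)) x := by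
  have h1 : HasDerivAt (fun w : ℂ => w + s * Complex.I) 1 (x:ℂ) := (hasDerivAt_id (x:ℂ)).add_const _
  exact ⟨by simpa using ((A0_deriv (x + s * Complex.I)).comp (x:ℂ) h1).comp_ofReal,
    by simpa using ((A1_deriv (x + s * Complex.I)).comp (x:ℂ) h1).comp_ofReal⟩

lemma C_vert (x : ℝ) : HasDerivAt (fun x : ℝ => C0 (x * Complex.I)) (Complex.I * C1 (x * Complex.I)) x ∧
    HasDerivAt (fun x : ℝ => Complex.I * C1 (x * Complex.I)) ((-(x * Complex.I)) * C0 (x * Complex.I)) x := by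
  have h1 : HasDerivAt (fun w : ℂ => w * Complex.I) Complex.I (x:ℂ) := by
    simpa using (hasDerivAt_id (x:ℂ)).mul_const Complex.I
  refine ⟨?_, ?_⟩
  · refine ((C0_deriv (x * Complex.I)).comp (x:ℂ) h1).comp_ofReal.congr_deriv ?_
    ring
  · refine (((C1_deriv (x * Complex.I)).comp (x:ℂ) h1).comp_ofReal.const_mul Complex.I).congr_deriv ?_
    linear_combination (x * Complex.I * C0 (x * Complex.I)) * Complex.I_sq

lemma A_sign (s x : ℝ) (hs : 0 ≤ s) (hx : 0 ≤ x) :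
    rD (A0 (x + s * Complex.I)) (A1 (x + s * Complex.I)) ≤ 0 ∧
    iD (A0 (x + s * Complex.I)) (A1 (x + s * Complex.I)) ≤ 0 := by
  obtain ⟨t0, t1⟩ := A_tendsto s
  constructor
  · refine nonpos_of_deriv (t0 := 0) (fun t _ => rD_deriv (A_horiz s t).1 (A_horiz s t).2) ?_
      (rD_tendsto t0 t1) hx
    intro t ht
    have h1 := nsq_nonneg (A0 (t + s * Complex.I))
    have h2 := nsq_nonneg (A1 (t + s * Complex.I))
    simp only [Complex.add_re, Complex.ofReal_re, Complex.re_ofReal_mul, Complex.I_re, mul_zero, add_zero]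
    positivity
  · refine nonpos_of_deriv (t0 := 0) (fun t _ => iD_deriv (A_horiz s t).1 (A_horiz s t).2) ?_
      (iD_tendsto t0 t1) hx
    intro t ht
    have h1 := nsq_nonneg (A0 (t + s * Complex.I))
    simp only [Complex.add_im, Complex.ofReal_im, Complex.im_ofReal_mul, Complex.I_im, mul_one, zero_add]
    positivity

lemma A_anti (s x y : ℝ) (hs : 0 ≤ s) (hx : 0 ≤ x) (hxy : x ≤ y) :
    ‖A0 (y + s * Complex.I)‖ ≤ ‖A0 (x + s * Complex.I)‖ := by
  have h := mono_of_deriv (t0 := 0) (φ := fun t => - nsq (A0 (t + s * Complex.I)))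
    (fun t _ => (nsq_deriv (A_horiz s t).1).neg) (fun t ht => by
      have := (A_sign s t hs ht).1; linarith) hx (hx.trans hxy) hxy
  simp only [nsq_eq] at h
  exact (sq_le_sq₀ (norm_nonneg _) (norm_nonneg _)).1 (by linarith)

lemma C_sign (x : ℝ) (hx : 1 ≤ x) :
    nsq (C0 (x * Complex.I)) ≤ 1 * rD (C0 (x * Complex.I)) (C1 (x * Complex.I)) +
      1 * iD (C0 (x * Complex.I)) (C1 (x * Complex.I)) := by
  obtain ⟨t0, t1⟩ := C_tendsto
  have h := nonpos_of_deriv (t0 := 1)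
    (fun t _ => ((nsq_deriv (C_vert t).1).add (rD_deriv (C_vert t).1 (C_vert t).2)).sub
      (iD_deriv (C_vert t).1 (C_vert t).2)) ?_
    (by
      have := ((nsq_tendsto t0).add (rD_tendsto t0 t1)).sub (iD_tendsto t0 t1)
      simp only [add_zero, sub_zero] at this
      exact this) hx
  · have e1 : rD (C0 (x * Complex.I)) (Complex.I * C1 (x * Complex.I)) =
      - iD (C0 (x * Complex.I)) (C1 (x * Complex.I)) := by simp [rD, iD]; ring
    have e2 : iD (C0 (x * Complex.I)) (Complex.I * C1 (x * Complex.I)) =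
      rD (C0 (x * Complex.I)) (C1 (x * Complex.I)) := by simp [rD, iD]
    simp only [Pi.add_apply, Pi.sub_apply] at h
    linarith
  · intro t ht
    have h1 := nsq_nonneg (C0 (t * Complex.I))
    have h2 := (abs_le.1 (two_rD_le (C0 (t * Complex.I)) (Complex.I * C1 (t * Complex.I)))).1
    simp only [Complex.neg_re, Complex.neg_im, Complex.re_ofReal_mul, Complex.im_ofReal_mul,
      Complex.I_re, Complex.I_im, mul_zero, mul_one, neg_zero, zero_mul, add_zero]
    nlinarith

lemma C_quad (x : ℝ) (hx : 1 ≤ x) :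
    0 ≤ rD (C0 (x * Complex.I)) (C1 (x * Complex.I)) ∧ 0 ≤ iD (C0 (x * Complex.I)) (C1 (x * Complex.I)) := by
  obtain ⟨t0, t1⟩ := C_tendsto
  have e1 : rD (C0 (x * Complex.I)) (Complex.I * C1 (x * Complex.I)) =
      - iD (C0 (x * Complex.I)) (C1 (x * Complex.I)) := by simp [rD, iD]; ring
  have e2 : iD (C0 (x * Complex.I)) (Complex.I * C1 (x * Complex.I)) =
      rD (C0 (x * Complex.I)) (C1 (x * Complex.I)) := by simp [rD, iD]
  constructor
  · have h := nonpos_of_deriv (t0 := 1) (fun t _ => (iD_deriv (C_vert t).1 (C_vert t).2).neg) ?_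
      (by
        have := (iD_tendsto t0 t1).neg
        rw [neg_zero] at this
        exact this) hx
    · simp only [Pi.neg_apply] at h
      linarith
    · intro t ht
      have h1 := nsq_nonneg (C0 (t * Complex.I))
      simp
      positivity
  · have h := nonpos_of_deriv (t0 := 1) (fun t _ => (rD_deriv (C_vert t).1 (C_vert t).2)) ?_
      (rD_tendsto t0 t1) hx
    · linarith
    · intro t ht
      have h1 := nsq_nonneg (Complex.I * C1 (t * Complex.I))
      simpa using h1

lemma wronsk_alg (c c' h h' : ℂ) (a b : ℝ) (ha : 0 ≤ a) (hb : 0 ≤ b) (hab : a + b ≤ 2)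
    (hc : nsq c ≤ a * rD c c' + b * iD c c') (h1 : rD h h' ≤ 0) (h2 : iD h h' ≤ 0) :
    ‖c * h‖ ≤ 2 * ‖c * h' - c' * h‖ := by
  set W := c * h' - c' * h with hW
  set X : ℂ := - (starRingEnd ℂ (c * h) * W) with hX
  have hre : X.re = nsq c * (- rD h h') + nsq h * rD c c' := by
    simp [hX, hW, nsq, rD]; ring
  have him : X.im = nsq c * (- iD h h') + nsq h * iD c c' := by
    simp [hX, hW, nsq, iD]; ring
  have hn : ‖X‖ = ‖c * h‖ * ‖W‖ := by
    rw [hX, norm_neg, norm_mul, Complex.norm_conj]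
  have h3 : nsq c * nsq h ≤ a * X.re + b * X.im := by
    rw [hre, him]
    have p1 := mul_le_mul_of_nonneg_left hc (nsq_nonneg h)
    have p2 := mul_nonneg ha (mul_nonneg (nsq_nonneg c) (neg_nonneg.2 h1))
    have p3 := mul_nonneg hb (mul_nonneg (nsq_nonneg c) (neg_nonneg.2 h2))
    nlinarith
  have h4 : a * X.re + b * X.im ≤ 2 * ‖X‖ := by
    have q1 := mul_le_mul_of_nonneg_left (Complex.re_le_norm X) ha
    have q2 := mul_le_mul_of_nonneg_left (Complex.im_le_norm X) hb
    have q3 := mul_le_mul_of_nonneg_right hab (norm_nonneg X)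
    nlinarith
  have h5 : ‖c * h‖ * ‖c * h‖ ≤ ‖c * h‖ * (2 * ‖W‖) := by
    have : nsq c * nsq h = ‖c * h‖ * ‖c * h‖ := by rw [nsq_eq, nsq_eq, norm_mul]; ring
    rw [hn] at h4
    nlinarith
  rcases (norm_nonneg (c * h)).eq_or_lt with h0 | h0
  · rw [← h0]; positivity
  · exact le_of_mul_le_mul_left h5 h0

lemma wronsk_const : ∃ W : ℂ, ∀ z, C0 z * A1 z - C1 z * A0 z = W := by
  refine ⟨C0 0 * A1 0 - C1 0 * A0 0, fun z => ?_⟩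
  have hd : ∀ z, HasDerivAt (fun z => C0 z * A1 z - C1 z * A0 z) 0 z := fun z =>
    (((C0_deriv z).mul (A1_deriv z)).sub ((C1_deriv z).mul (A0_deriv z))).congr_deriv (by ring)
  exact is_const_of_deriv_eq_zero (fun z => (hd z).differentiableAt) (fun z => (hd z).deriv) z 0

lemma cont_bdd {f : ℝ → ℂ} (hf : Continuous f) (a b : ℝ) : ∃ K, ∀ x, a ≤ x → x ≤ b → ‖f x‖ ≤ K := by
  obtain ⟨K, hK⟩ := (isCompact_Icc (a := a) (b := b)).exists_bound_of_continuousOn hf.continuousOn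
  exact ⟨K, fun x h1 h2 => hK x ⟨h1, h2⟩⟩

lemma A0_cont : Continuous A0 := by
  rw [continuous_iff_continuousAt]; exact fun z => (A0_deriv z).continuousAt
lemma C0_cont : Continuous C0 := by
  rw [continuous_iff_continuousAt]; exact fun z => (C0_deriv z).continuousAt

/-- Solutions of the Airy equation are bounded on left half lines. -/
lemma neg_bdd (f g : ℂ → ℂ) (hf : ∀ z, HasDerivAt f (g z) z) (hg : ∀ z, HasDerivAt g (z * f z) z)
    (M : ℝ) : ∃ K, ∀ x : ℝ, x ≤ M → ‖f x‖ ≤ K := by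
  have hc : Continuous f := by
    rw [continuous_iff_continuousAt]; exact fun z => (hf z).continuousAt
  obtain ⟨K1, hK1⟩ := cont_bdd (hc.comp Complex.continuous_ofReal) (-1) M
  have hneg : ∀ t : ℝ, HasDerivAt (fun w : ℂ => -w) (-1) (t:ℂ) := fun t => (hasDerivAt_id (t:ℂ)).neg
  have d1 : ∀ t : ℝ, HasDerivAt (fun t : ℝ => f (-(t:ℂ))) (-(g (-(t:ℂ)))) t := fun t =>
    (((hf (-t)).comp (t:ℂ) (hneg t)).comp_ofReal).congr_deriv (by ring)
  have d2 : ∀ t : ℝ, HasDerivAt (fun t : ℝ => g (-(t:ℂ))) ((t:ℂ) * f (-(t:ℂ))) t := fun t =>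
    (((hg (-t)).comp (t:ℂ) (hneg t)).comp_ofReal).congr_deriv (by ring)
  have hQ : ∀ t : ℝ, 1 ≤ t → HasDerivAt (fun t : ℝ => -(nsq (f (-(t:ℂ))) + nsq (g (-(t:ℂ))) / t))
      (nsq (g (-(t:ℂ))) / t ^ 2) t := by
    intro t ht
    have ht0 : t ≠ 0 := by linarith
    refine ((nsq_deriv (d1 t)).add ((nsq_deriv (d2 t)).div (hasDerivAt_id t) ht0)).neg.congr_deriv ?_
    simp [rD]
    field_simp
    ring
  have hm := mono_of_deriv hQ (fun t ht => div_nonneg (nsq_nonneg _) (by positivity))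
  set Q1 := nsq (f (-((1:ℝ):ℂ))) + nsq (g (-((1:ℝ):ℂ))) / 1 with hQ1
  refine ⟨max K1 (Real.sqrt Q1), fun x hx => ?_⟩
  by_cases h : -1 ≤ x
  · exact (hK1 x h hx).trans (le_max_left _ _)
  · push Not at h
    refine le_trans ?_ (le_max_right _ _)
    have h1 := hm (a := 1) (b := -x) (by simp) (by simp; linarith) (by linarith)
    simp only at h1
    have h2 : 0 ≤ nsq (g (-((-x : ℝ):ℂ))) / (-x) := div_nonneg (nsq_nonneg _) (by linarith)
    apply Real.le_sqrt_of_sq_le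
    rw [← nsq_eq]
    have e : -((-x : ℝ):ℂ) = x := by simp
    rw [e] at h1 h2
    rw [hQ1]
    linarith

/-- Boundedness on the right half line. -/
lemma pos_bdd (q : ℝ) (hq : 0 ≤ q) : ∃ K, ∀ x : ℝ, 0 ≤ x → ‖C0 x * A0 (q + x)‖ ≤ K := by
  obtain ⟨W, hW⟩ := wronsk_const
  have dC : ∀ t : ℝ, HasDerivAt (fun t : ℝ => C0 t) (C1 t) t := fun t => (C0_deriv t).comp_ofReal
  have dC1 : ∀ t : ℝ, HasDerivAt (fun t : ℝ => C1 t) (t * C0 t) t := fun t => (C1_deriv t).comp_ofReal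
  have hm := mono_of_deriv (t0 := 1) (fun t _ => (rD_deriv (dC t) (dC1 t)).sub (nsq_deriv (dC t))) (by
    intro t ht
    have h1 := nsq_nonneg (C0 t)
    have h2 := (abs_le.1 (two_rD_le (C0 t) (C1 t))).2
    simp only [Complex.ofReal_re]
    nlinarith)
  set K := |rD (C0 (1:ℝ)) (C1 (1:ℝ)) - nsq (C0 (1:ℝ))|
  obtain ⟨K1, hK1⟩ := cont_bdd (C0_cont.comp Complex.continuous_ofReal) 0 1
  have hA0 : ∀ x : ℝ, 0 ≤ x → ‖A0 x‖ ≤ ‖A0 0‖ := by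
    intro x hx
    simpa using A_anti 0 0 x le_rfl le_rfl hx
  have hA : ∀ x : ℝ, 0 ≤ x → ‖A0 (q + x)‖ ≤ ‖A0 x‖ := by
    intro x hx
    have := A_anti 0 x (q + x) le_rfl hx (by linarith)
    simpa using this
  refine ⟨max (K1 * ‖A0 0‖) (max (Real.sqrt (2 * K) * ‖A0 0‖) (2 * ‖W‖)), fun x hx => ?_⟩
  have hle : ‖C0 x * A0 (q + x)‖ ≤ ‖C0 x * A0 x‖ := by
    rw [norm_mul, norm_mul]
    exact mul_le_mul_of_nonneg_left (hA x hx) (norm_nonneg _)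
  refine hle.trans ?_
  by_cases h1 : x ≤ 1
  · refine le_trans ?_ (le_max_left _ _)
    rw [norm_mul]
    exact mul_le_mul (hK1 x hx h1) (hA0 x hx) (norm_nonneg _) ((norm_nonneg _).trans (hK1 x hx h1))
  push Not at h1
  refine le_trans ?_ (le_max_right _ _)
  have hmx := hm (a := 1) (b := x) (by simp) h1.le h1.le
  simp only [Pi.sub_apply] at hmx
  have hK : -K ≤ rD (C0 (1:ℝ)) (C1 (1:ℝ)) - nsq (C0 (1:ℝ)) := neg_abs_le _
  by_cases h2 : nsq (C0 x) ≤ 2 * K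
  · refine le_trans ?_ (le_max_left _ _)
    rw [norm_mul]
    refine mul_le_mul ?_ (hA0 x hx) (norm_nonneg _) (Real.sqrt_nonneg _)
    apply Real.le_sqrt_of_sq_le
    rwa [← nsq_eq]
  · push Not at h2
    refine le_trans ?_ (le_max_right _ _)
    rw [← hW x]
    have hs := A_sign 0 x le_rfl hx
    simp only [Complex.ofReal_zero, zero_mul, add_zero] at hs
    exact wronsk_alg _ _ _ _ 2 0 (by norm_num) le_rfl (by norm_num) (by linarith) hs.1 hs.2

lemma vert_bdd (q : ℝ) (hq : 0 ≤ q) : ∃ K, ∀ x : ℝ, 0 ≤ x → ‖C0 (x * Complex.I) * A0 (q + x * Complex.I)‖ ≤ K := by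
  obtain ⟨W, hW⟩ := wronsk_const
  have hcont : Continuous fun x : ℝ => C0 (x * Complex.I) * A0 (q + x * Complex.I) :=
    (C0_cont.comp (by fun_prop)).mul (A0_cont.comp (by fun_prop))
  obtain ⟨K1, hK1⟩ := cont_bdd hcont 0 1
  refine ⟨max K1 (2 * ‖W‖), fun x hx => ?_⟩
  by_cases h1 : x ≤ 1
  · exact (hK1 x hx h1).trans (le_max_left _ _)
  push Not at h1
  refine le_trans ?_ (le_max_right _ _)
  have h2 := A_anti x 0 q hx le_rfl hq
  have h3 := A_sign x 0 hx le_rfl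
  simp only [Complex.ofReal_zero, zero_add] at h2 h3
  have h4 := wronsk_alg _ _ _ _ 1 1 (by norm_num) (by norm_num) (by norm_num) (C_sign x h1.le) h3.1 h3.2
  rw [hW] at h4
  refine le_trans ?_ h4
  rw [norm_mul, norm_mul]
  exact mul_le_mul_of_nonneg_left h2 (norm_nonneg _)

lemma mEk_growth (k : ℂ) (hk : ‖k‖ = 1) (z : ℂ) :
    ‖k * mE 0 (k * z)‖ ≤ DE 0 * Real.exp (3 * ‖z‖ ^ (3/2:ℝ)) := by
  have := mE_growth 0 (k * z)
  rw [norm_mul, hk, one_mul] at this ⊢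
  exact this

lemma A0_growth : ∃ K, ∀ z, ‖A0 z‖ ≤ K * Real.exp (3 * ‖z‖ ^ (3/2:ℝ)) := by
  refine ⟨‖1 / (2 * Real.pi * Complex.I)‖ * (DE 0 + DE 0), fun z => ?_⟩
  rw [A0, norm_mul, mul_assoc _ (DE 0 + DE 0), add_mul]
  refine mul_le_mul_of_nonneg_left ?_ (norm_nonneg _)
  exact (norm_sub_le _ _).trans (add_le_add (mEk_growth om norm_om z) (mEk_growth omb norm_omb z))

lemma C0_growth : ∃ K, ∀ z, ‖C0 z‖ ≤ K * Real.exp (3 * ‖z‖ ^ (3/2:ℝ)) := by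
  refine ⟨‖(1 / Real.pi : ℂ)‖ * (DE 0 + DE 0), fun z => ?_⟩
  rw [C0, norm_mul, mul_assoc _ (DE 0 + DE 0), add_mul]
  refine mul_le_mul_of_nonneg_left ?_ (norm_nonneg _)
  exact (norm_sub_le _ _).trans (add_le_add (mEk_growth om norm_om z) (mE_growth 0 z))

lemma F_growth (q : ℝ) (l : Filter ℂ) : ∃ c < (2 : ℝ), ∃ B,
      (fun z => C0 z * A0 (q + z)) =O[Bornology.cobounded ℂ ⊓ l] fun z => Real.exp (B * ‖z‖ ^ c) := by
  obtain ⟨K1, h1⟩ := A0_growth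
  obtain ⟨K2, h2⟩ := C0_growth
  refine ⟨3/2, by norm_num, 3 + 3 * 2 ^ (3/2:ℝ), ?_⟩
  refine Asymptotics.IsBigO.of_bound (K2 * K1) ?_
  refine Eventually.filter_mono inf_le_left ?_
  filter_upwards [(tendsto_norm_cobounded_atTop (E := ℂ)).eventually_ge_atTop |q|] with z hz
  have h3 : ‖(q:ℂ) + z‖ ≤ 2 * ‖z‖ := by
    refine (norm_add_le _ _).trans ?_
    rw [Complex.norm_real, Real.norm_eq_abs]; linarith
  have h4 : ‖(q:ℂ) + z‖ ^ (3/2:ℝ) ≤ 2 ^ (3/2:ℝ) * ‖z‖ ^ (3/2:ℝ) := by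
    rw [← Real.mul_rpow (by norm_num) (norm_nonneg _)]
    exact Real.rpow_le_rpow (norm_nonneg _) h3 (by norm_num)
  have hK1 : 0 ≤ K1 := by
    have := (norm_nonneg _).trans (h1 0)
    exact nonneg_of_mul_nonneg_left this (Real.exp_pos _)
  rw [norm_mul, Real.norm_of_nonneg (Real.exp_pos _).le]
  have h5 : ‖A0 (q + z)‖ ≤ K1 * Real.exp (3 * (2 ^ (3/2:ℝ) * ‖z‖ ^ (3/2:ℝ))) := by
    refine (h1 _).trans ?_
    gcongr
  refine (mul_le_mul (h2 z) h5 (norm_nonneg _) ((norm_nonneg _).trans (h2 z))).trans (le_of_eq ?_)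
  rw [add_mul, Real.exp_add, mul_assoc 3]
  ring

lemma F_bdd (q : ℝ) (hq : 0 ≤ q) : ∃ K, ∀ z : ℂ, 0 ≤ z.im → ‖C0 z * A0 (q + z)‖ ≤ K := by
  obtain ⟨K1, h1⟩ := pos_bdd q hq
  obtain ⟨K2, h2⟩ := vert_bdd q hq
  obtain ⟨K3, h3⟩ := neg_bdd C0 C1 C0_deriv C1_deriv 0
  obtain ⟨K4, h4⟩ := neg_bdd A0 A1 A0_deriv A1_deriv q
  have hd : Differentiable ℂ fun z => C0 z * A0 (q + z) := fun z =>
    (C0_deriv z).differentiableAt.mul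
      ((A0_deriv (q + z)).differentiableAt.comp z (by fun_prop))
  refine ⟨max (max K1 K2) (K3 * K4), fun z hz => ?_⟩
  rcases le_total 0 z.re with hr | hr
  · refine PhragmenLindelof.quadrant_I (f := fun z => C0 z * A0 (q + z)) hd.diffContOnCl
      (F_growth q _) ?_ ?_ hr hz
    · exact fun x hx => (h1 x hx).trans ((le_max_left _ _).trans (le_max_left _ _))
    · exact fun x hx => (h2 x hx).trans ((le_max_right _ _).trans (le_max_left _ _))
  · refine PhragmenLindelof.quadrant_II (f := fun z => C0 z * A0 (q + z)) hd.diffContOnCl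
      (F_growth q _) ?_ ?_ hr hz
    · intro x hx
      refine le_trans ?_ (le_max_right _ _)
      have := h4 (q + x) (by linarith)
      push_cast at this
      rw [norm_mul]
      exact mul_le_mul (h3 x hx) this (norm_nonneg _) ((norm_nonneg _).trans (h3 x hx))
    · exact fun x hx => (h2 x hx).trans ((le_max_right _ _).trans (le_max_left _ _))

lemma poisson_integral (w : ℂ) (hw : 0 < w.im) :
    Integrable (fun u : ℝ => w.im / ((u - w.re) ^ 2 + w.im ^ 2)) ∧
    ∫ u : ℝ, w.im / ((u - w.re) ^ 2 + w.im ^ 2) = Real.pi := by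
  have e : (fun u : ℝ => w.im / ((u - w.re) ^ 2 + w.im ^ 2)) =
      fun u : ℝ => (fun v : ℝ => (w.im)⁻¹ * (fun t : ℝ => (1 + t^2)⁻¹) (v / w.im)) (u - w.re) := by
    ext u; simp only []; field_simp; ring
  rw [e]
  constructor
  · exact (((integrable_inv_one_add_sq.comp_div hw.ne').const_mul _).comp_sub_right w.re)
  · rw [integral_sub_right_eq_self (fun v : ℝ => (w.im)⁻¹ * (fun t : ℝ => (1 + t^2)⁻¹) (v / w.im)) w.re,
      integral_const_mul, Measure.integral_comp_div (fun t : ℝ => (1 + t^2)⁻¹) w.im, integral_univ_inv_one_add_sq, abs_of_pos hw]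
    simp [hw.ne']

/-- Poisson representation of a bounded holomorphic function in the upper half plane. -/
lemma poisson_rep (F : ℂ → ℂ) (hF : Differentiable ℂ F) (B : ℝ)
    (hB : ∀ z : ℂ, 0 ≤ z.im → ‖F z‖ ≤ B) (w : ℂ) (hw : 0 < w.im) :
    ∫ u : ℝ, F u * ((w.im / ((u - w.re) ^ 2 + w.im ^ 2) : ℝ) : ℂ) = Real.pi * F w := by
  obtain ⟨hPi, hPe⟩ := poisson_integral w hw
  have hB0 : 0 ≤ B := (norm_nonneg _).trans (hB w hw.le)
  set P : ℝ → ℝ := fun u => w.im / ((u - w.re) ^ 2 + w.im ^ 2) with hP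
  have hFc : Continuous F := hF.continuous
  have hint : Integrable (fun u : ℝ => F u * (P u : ℂ)) := by
    refine Integrable.bdd_mul (c := B) hPi.ofReal
      (hFc.comp Complex.continuous_ofReal).aestronglyMeasurable ?_
    exact Eventually.of_forall fun u => hB u (by simp)
  have hint2 : Integrable (fun u : ℝ => (F u - F w) * (P u : ℂ)) := by
    simp only [sub_mul]
    exact hint.sub (hPi.ofReal.const_mul _)
  suffices h : ∫ u : ℝ, (F u - F w) * (P u : ℂ) = 0 by
    simp only [sub_mul] at h
    have hPiC : Integrable (fun u : ℝ => F w * ((P u : ℝ) : ℂ)) := hPi.ofReal.const_mul (F w)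
    rw [integral_sub hint hPiC, integral_const_mul] at h
    have hPe' : ∫ u : ℝ, ((P u : ℝ) : ℂ) = Real.pi := by
      rw [← hPe]; exact integral_ofReal
    rw [hPe'] at h
    linear_combination h
  -- the contour integrand
  let wb : ℂ := starRingEnd ℂ w
  let g : ℂ → ℂ := fun z => dslope F w z * (w.im / (z - wb))
  have hwb : ∀ z : ℂ, 0 ≤ z.im → z - wb ≠ 0 := by
    intro z hz h
    have := congrArg Complex.im h
    simp [wb] at this
    linarith
  have hds : Differentiable ℂ (dslope F w) := by
    intro z
    exact ((Complex.differentiableOn_dslope (s := univ) univ_mem).2 hF.differentiableOn).differentiableAt univ_mem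
  have hgd : ∀ z : ℂ, 0 ≤ z.im → DifferentiableAt ℂ g z := by
    intro z hz
    exact (hds z).mul ((differentiableAt_const _).div (differentiableAt_id.sub_const _) (hwb z hz))
  have hg : ∀ z : ℂ, z ≠ w → g z = (F z - F w) * (w.im / ((z - w) * (z - wb))) := by
    intro z hz
    simp only [g]
    rw [dslope_of_ne _ hz, slope_def_field]
    rw [div_mul_div_comm, mul_div_assoc]
  have hgreal : ∀ u : ℝ, g u = (F u - F w) * (P u : ℂ) := by
    intro u
    have hne : (u:ℂ) ≠ w := by
      intro h; rw [← h] at hw; simp at hw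
    rw [hg _ hne]
    congr 1
    simp only [hP]
    push_cast
    congr 1
    have : wb = w.re - w.im * Complex.I := by
      apply Complex.ext <;> simp [wb]
    rw [this]
    nth_rewrite 1 [← Complex.re_add_im w]
    ring_nf
    rw [Complex.I_sq]; ring
  have hbd : ∀ R : ℝ, 2 * ‖w‖ + 1 ≤ R → ∀ z : ℂ, 0 ≤ z.im → R ≤ ‖z‖ →
      ‖g z‖ ≤ 8 * B * w.im / R ^ 2 := by
    intro R hR z hz hzR
    have hw0 := norm_nonneg w
    have hne : z ≠ w := by
      rintro rfl; linarith
    rw [hg z hne, norm_mul, norm_div, norm_mul, Complex.norm_real, Real.norm_of_nonneg hw.le]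
    have h1 : ‖F z - F w‖ ≤ 2 * B := by
      refine (norm_sub_le _ _).trans ?_
      linarith [hB z hz, hB w hw.le]
    have h2 : R / 2 ≤ ‖z - w‖ := by
      have := norm_sub_norm_le z w; linarith
    have h3 : R / 2 ≤ ‖z - wb‖ := by
      have := norm_sub_norm_le z wb
      have e : ‖wb‖ = ‖w‖ := Complex.norm_conj w
      linarith
    have hRp : 0 < R := by linarith
    calc _ ≤ 2 * B * (w.im / (R / 2 * (R / 2))) := by gcongr
      _ = _ := by field_simp; ring
  have hrect : ∀ R : ℝ, 2 * ‖w‖ + 1 ≤ R → ‖∫ u in (-R)..R, (F u - F w) * (P u : ℂ)‖ ≤ 32 * B * w.im / R := by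
    intro R hR
    have hw0 := norm_nonneg w
    have hRp : 0 < R := by linarith
    have key := Complex.integral_boundary_rect_eq_zero_of_differentiableOn g (-R : ℝ) (R + R * Complex.I) (by
      intro z hz
      refine (hgd z ?_).differentiableWithinAt
      have := hz.2
      simp [hRp.le] at this
      exact this.1)
    simp at key
    have e1 : ∫ u in (-R)..R, g u = ∫ u in (-R)..R, (F u - F w) * (P u : ℂ) := by
      simp only [hgreal]
    rw [e1] at key
    have b1 : ‖∫ u in (-R)..R, g (u + R * Complex.I)‖ ≤ 8 * B * w.im / R ^ 2 * |R - (-R)| := by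
      refine intervalIntegral.norm_integral_le_of_norm_le_const fun u _ => hbd R hR _ (by simpa using hRp.le) ?_
      have := Complex.abs_im_le_norm (u + R * Complex.I)
      simp [abs_of_pos hRp] at this
      exact this
    have b2 : ‖∫ u in (0:ℝ)..R, g (R + u * Complex.I)‖ ≤ 8 * B * w.im / R ^ 2 * |R - 0| := by
      refine intervalIntegral.norm_integral_le_of_norm_le_const fun u hu => hbd R hR _ ?_ ?_
      · rw [uIoc_of_le hRp.le] at hu; simpa using hu.1.le
      have := Complex.abs_re_le_norm (R + u * Complex.I)
      simp [abs_of_pos hRp] at this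
      exact this
    have b3 : ‖∫ u in (0:ℝ)..R, g (-R + u * Complex.I)‖ ≤ 8 * B * w.im / R ^ 2 * |R - 0| := by
      refine intervalIntegral.norm_integral_le_of_norm_le_const fun u hu => hbd R hR _ ?_ ?_
      · rw [uIoc_of_le hRp.le] at hu; simpa using hu.1.le
      have := Complex.abs_re_le_norm (-R + u * Complex.I)
      simp [abs_of_pos hRp] at this
      exact this
    have e2 : ∫ u in (-R)..R, (F u - F w) * (P u : ℂ) =
      (∫ u in (-R)..R, g (u + R * Complex.I)) - Complex.I * (∫ u in (0:ℝ)..R, g (R + u * Complex.I))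
       + Complex.I * (∫ u in (0:ℝ)..R, g (-R + u * Complex.I)) := by
      linear_combination key
    rw [e2]
    refine (norm_add_le _ _).trans ((add_le_add_left (norm_sub_le _ _) _).trans ?_)
    rw [norm_mul, norm_mul, Complex.norm_I, one_mul, one_mul]
    refine (add_le_add (add_le_add b1 b2) b3).trans (le_of_eq ?_)
    rw [show R - -R = 2 * R by ring, abs_of_pos (by positivity), sub_zero, abs_of_pos hRp]
    field_simp; ring
  have hlim := intervalIntegral_tendsto_integral hint2 tendsto_neg_atTop_atBot tendsto_id
  have hlim0 : Tendsto (fun R : ℝ => ∫ u in (-R)..R, (F u - F w) * (P u : ℂ)) atTop (nhds 0) := by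
    rw [tendsto_zero_iff_norm_tendsto_zero]
    refine squeeze_zero' (Eventually.of_forall fun _ => norm_nonneg _)
      (g := fun R => 32 * B * w.im / R) ?_ (tendsto_const_nhds.div_atTop tendsto_id)
    filter_upwards [eventually_ge_atTop (2 * ‖w‖ + 1)] with R hR using hrect R hR
  exact tendsto_nhds_unique hlim hlim0

lemma core_identity (Ai Bi : ℂ → ℂ) (hAi : IsAiryAi Ai) (hBi : IsAiryBi Bi) (q : ℝ) (hq : 0 ≤ q)
    (w : ℂ) (hw : 0 < w.im) :
    Real.pi * ((Complex.I * Ai w - Bi w) * Ai (q + w)).im =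
      ∫ u : ℝ, AiR Ai u * AiR Ai (q + u) * (w.im / ((u - w.re) ^ 2 + w.im ^ 2)) := by
  obtain ⟨K, hK⟩ := F_bdd q hq
  have hd : Differentiable ℂ fun z => C0 z * A0 (q + z) := fun z =>
    (C0_deriv z).differentiableAt.mul
      ((A0_deriv (q + z)).differentiableAt.comp z (by fun_prop))
  have h := poisson_rep _ hd K hK w hw
  have hC := Ci_eq Ai Bi hAi hBi
  have hA := Ai_eq Ai hAi
  rw [← hC] at h
  rw [← hA] at h
  have hint : Integrable (fun u : ℝ => ((Complex.I * Ai u - Bi u) * Ai (q + u)) *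
      ((w.im / ((u - w.re) ^ 2 + w.im ^ 2) : ℝ) : ℂ)) := by
    refine Integrable.bdd_mul (c := K) (poisson_integral w hw).1.ofReal ?_ ?_
    · have c1 := hAi.1.continuous
      have c2 := hBi.1.continuous
      apply Continuous.aestronglyMeasurable
      fun_prop
    · refine Eventually.of_forall fun u => ?_
      have := hK u (by simp)
      rw [← hC, ← hA] at this
      exact this
  have h2 := congrArg Complex.im h
  have h3 := Complex.imCLM.integral_comp_comm hint
  simp only [Complex.imCLM_apply] at h3
  simp only at h2
  rw [← h3, Complex.im_ofReal_mul] at h2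
  rw [← h2]
  congr 1
  ext u
  rw [Complex.im_mul_ofReal]
  congr 1
  have i1 := (hAi.2.2 u).1
  have i2 := (hBi.2.2 u).1
  have i3 := (hAi.2.2 (q + u)).1
  rw [AiR, AiR]
  push_cast at i3 ⊢
  simp [i1, i2, i3]

lemma change_var (p γ : ℝ) (hγ : 0 < γ) (ζ : ℂ)
    (G : ℝ → ℝ) :
    ∫ ξ : ℝ, G (p + γ * ξ) * (ζ.im / ((ξ - ζ.re) ^ 2 + ζ.im ^ 2)) =
      ∫ u : ℝ, G u * (((p + γ * ζ : ℂ)).im / ((u - ((p + γ * ζ : ℂ)).re) ^ 2 + ((p + γ * ζ : ℂ)).im ^ 2)) := by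
  have e1 : ((p + γ * ζ : ℂ)).im = γ * ζ.im := by simp
  have e2 : ((p + γ * ζ : ℂ)).re = p + γ * ζ.re := by simp
  rw [e1, e2]
  set H : ℝ → ℝ := fun u => G u * (γ * ζ.im / ((u - (p + γ * ζ.re)) ^ 2 + (γ * ζ.im) ^ 2)) with hH
  rw [← integral_add_left_eq_self H p]
  have h2 := Measure.integral_comp_mul_left (fun u => H (p + u)) γ
  rw [abs_of_pos (inv_pos.2 hγ), smul_eq_mul] at h2
  have h3 : ∫ u, H (p + u) = γ * ∫ ξ, H (p + γ * ξ) := by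
    rw [h2]; field_simp
  rw [h3, ← integral_const_mul]
  congr 1
  ext ξ
  simp only [hH]
  have : (p + γ * ξ - (p + γ * ζ.re)) ^ 2 + (γ * ζ.im) ^ 2 = γ ^ 2 * ((ξ - ζ.re) ^ 2 + ζ.im ^ 2) := by ring
  rw [this, show γ * ζ.im = γ ^ 2 * (ζ.im / γ) by field_simp, mul_div_mul_left _ _ (by positivity)]
  field_simp

lemma kernel_le (Ai Bi : ℂ → ℂ) (hAi : IsAiryAi Ai) (hBi : IsAiryBi Bi)
    (κ γ a : ℝ) (hκ : 0 < κ) (hγ : 0 < γ) (ζ : ℂ) (hζ : 0 < ζ.im) (x y : ℝ) (hxy : x ≤ y) :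
    ((2 * Real.pi / (κ * a)) * (Complex.I * Ai (κ * x + γ * ζ) - Bi (κ * x + γ * ζ)) *
      Ai (κ * y + γ * ζ) : ℂ).im = (2 / (κ * a)) *
          ∫ ξ : ℝ, AiR Ai (κ * x + γ * ξ) * AiR Ai (κ * y + γ * ξ) *
              (ζ.im / ((ξ - ζ.re) ^ 2 + ζ.im ^ 2)) := by
  have hq : 0 ≤ κ * y - κ * x := by
    have := mul_le_mul_of_nonneg_left hxy hκ.le
    linarith
  have hw : 0 < (((κ * x : ℝ) : ℂ) + γ * ζ).im := by
    simp only [Complex.add_im, Complex.ofReal_im, Complex.im_ofReal_mul, zero_add]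
    positivity
  have h1 := core_identity Ai Bi hAi hBi _ hq _ hw
  rw [← change_var (κ * x) γ hγ ζ (fun u => AiR Ai u * AiR Ai (κ * y - κ * x + u))] at h1
  have h2 : ∀ ξ : ℝ, κ * y - κ * x + (κ * x + γ * ξ) = κ * y + γ * ξ := fun ξ => by ring
  simp only [h2] at h1
  rw [← h1]
  have h3 : (((κ * y - κ * x : ℝ)) : ℂ) + (((κ * x : ℝ) : ℂ) + γ * ζ) = κ * y + γ * ζ := by
    push_cast; ring
  rw [h3, Complex.ofReal_mul]
  have h4 : (2 * Real.pi / (κ * a) : ℂ) = ((2 / (κ * a) * Real.pi : ℝ) : ℂ) := by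
    push_cast; ring
  rw [mul_assoc, h4, Complex.im_ofReal_mul]
  ring

theorem green_kernel_spectral_representation
    (Ai Bi : ℂ → ℂ) (hAi : IsAiryAi Ai) (hBi : IsAiryBi Bi)
    (a c : ℝ) (ha : 0 < a) (hc : 0 < c) (ζ : ℂ) (hζ : 0 < ζ.im) :
    ∀ x y : ℝ,
      (greenKernel Ai Bi a c ζ x y).im =
        (2 / ((4 * c / a) ^ ((1:ℝ)/3) * a)) *
          ∫ ξ : ℝ,
            AiR Ai ((4 * c / a) ^ ((1:ℝ)/3) * x + (2 * c ^ 2 * a) ^ (-(1:ℝ)/3) * ξ) *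
              AiR Ai ((4 * c / a) ^ ((1:ℝ)/3) * y + (2 * c ^ 2 * a) ^ (-(1:ℝ)/3) * ξ) *
              (ζ.im / ((ξ - ζ.re) ^ 2 + ζ.im ^ 2)) := by
  intro x y
  have hκ : 0 < (4 * c / a) ^ ((1:ℝ)/3) := Real.rpow_pos_of_pos (by positivity) _
  have hγ : 0 < (2 * c ^ 2 * a) ^ (-(1:ℝ)/3) := Real.rpow_pos_of_pos (by positivity) _
  unfold greenKernel
  simp only
  split_ifs with hxy
  · exact kernel_le Ai Bi hAi hBi _ _ a hκ hγ ζ hζ x y hxy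
  · rw [kernel_le Ai Bi hAi hBi _ _ a hκ hγ ζ hζ y x (le_of_lt (not_le.1 hxy))]
    congr 1
    refine integral_congr_ae (Eventually.of_forall fun ξ => ?_)
    simp only
    ring
end
end
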